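/- arXiv:1701.08826 — 3 statements merged into one kernel-verified Lean document; each statement's English description precedes it below -/
import Mathlib

section
/- Let Q be a quiver with finitely many vertices 1,…,t and finitely many arrows, and let A and B be real matrix representations of Q of the same dimension (d₁,…,d_t), i.e., assignments to each arrow α: u → v of real d_v×d_u matrices A_α and B_α. Then A and B are real orthogonally isometric — i.e., there exist real orthogonal matrices U₁,…,U_t with B_α = U_v⁻¹ A_α U_u for every arrow α: u → v — if and only if trace Ã(π) = trace B̃(π) for every oriented cycle π in the doubled quiver Q̃, where Ã assigns A_α to each original arrow α and the transpose A_αᵀ to each reversed arrow α*. -/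
open Matrix Quiver

/-- The product of the matrices assigned by a real matrix representation `A` along a
directed path. -/
noncomputable def pathMatrixR {V : Type} [Quiver V] (d : V → ℕ)
    (A : ∀ u v : V, (u ⟶ v) → Matrix (Fin (d v)) (Fin (d u)) ℝ) :
    ∀ {u v : V}, Path u v → Matrix (Fin (d v)) (Fin (d u)) ℝ
  | _, _, Path.nil => 1
  | _, _, Path.cons p e => A _ _ e * pathMatrixR d A p

/-- The real matrix representation of the doubled quiver `Symmetrify V` induced by a real
matrix representation `A` of `V`: original arrows keep their matrices, and each reversed
arrow gets the transpose of the matrix of the corresponding original arrow. -/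
noncomputable def doubledRepRT {V : Type} [Quiver V] (d : V → ℕ)
    (A : ∀ u v : V, (u ⟶ v) → Matrix (Fin (d v)) (Fin (d u)) ℝ) :
    ∀ u v : Symmetrify V, (u ⟶ v) → Matrix (Fin (d v)) (Fin (d u)) ℝ :=
  fun _ _ e => match e with
    | Sum.inl a => A _ _ a
    | Sum.inr a => (A _ _ a)ᵀ

namespace Matrix

section StarSubalgebra

variable {n : Type*} [Fintype n]

/-- Every space of real matrices has a Parseval frame for the trace inner product. -/
theorem exists_trace_expansion (K : Submodule ℝ (Matrix n n ℝ)) :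
    ∃ (k : ℕ) (b : Fin k → Matrix n n ℝ), (∀ i, b i ∈ K) ∧
      ∀ x ∈ K, x = ∑ i, ((b i)ᴴ * x).trace • b i := by
  classical
  let : NormedAddCommGroup (Matrix n n ℝ) := toMatrixNormedAddCommGroup 1 PosDef.one
  let : InnerProductSpace ℝ (Matrix n n ℝ) := toMatrixInnerProductSpace 1 PosSemidef.one
  let b := stdOrthonormalBasis ℝ K
  refine ⟨_, fun i => (b i : Matrix n n ℝ), fun i => (b i).2, fun x hx => ?_⟩
  have h := congrArg Subtype.val (b.sum_repr' ⟨x, hx⟩)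
  have hinner (y : Matrix n n ℝ) : inner ℝ y x = (yᴴ * x).trace := by
    change (x * 1 * yᴴ).trace = _
    rw [mul_one, trace_mul_comm]
  simpa [hinner] using h.symm

theorem eq_zero_of_isIdempotentElem_of_trace_eq_zero {e : Matrix n n ℝ} (hs : e.IsHermitian)
    (he : e * e = e) (ht : e.trace = 0) : e = 0 := by
  rw [← trace_conjTranspose_mul_self_eq_zero_iff, hs.eq, he, ht]

theorem exists_nat_trace_eq_of_isIdempotentElem {e : Matrix n n ℝ} (he : e * e = e) :
    ∃ k : ℕ, e.trace = k := by
  classical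
  have h : IsIdempotentElem (toLin' e) := by
    rw [IsIdempotentElem, Module.End.mul_eq_comp, ← toLin'_mul, he]
  exact ⟨_, by rw [← trace_toLin'_eq, (LinearMap.IsIdempotentElem.isProj_range _ h).trace]⟩

variable [DecidableEq n]

/-- Polar decomposition, in the form of a partial isometry `T * G` where `G` lies in the bicommutant
of `Tᴴ * T`. -/
theorem exists_partialIsometry (T : Matrix n n ℝ) :
    ∃ G : Matrix n n ℝ, (∀ x, Commute (Tᴴ * T) x → Commute G x) ∧
      T * G * (T * G)ᴴ * (T * G) = T * G ∧ (T * G = 0 → T = 0) := by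
  have hH : IsSelfAdjoint (Tᴴ * T) := isHermitian_conjTranspose_mul_self T
  have hc (f : ℝ → ℝ) : ContinuousOn f (spectrum ℝ (Tᴴ * T)) :=
    (finite_real_spectrum (A := Tᴴ * T)).continuousOn f
  set H := Tᴴ * T with hHdef
  set G := cfc (fun t : ℝ => (√t)⁻¹) H with hG
  have hGs : Gᴴ = G := (cfc_predicate _ H : IsSelfAdjoint G)
  have hnn : ∀ t ∈ spectrum ℝ H, 0 ≤ t := by
    intro t ht
    exact (posSemidef_conjTranspose_mul_self T).isHermitian.spectrum_real_eq_range_eigenvalues ▸ ht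
      |> fun ⟨i, hi⟩ => hi ▸ (posSemidef_conjTranspose_mul_self T).eigenvalues_nonneg i
  have hGHG : G * H * G = cfc (fun t : ℝ => if t = 0 then 0 else 1) H := by
    have : G * H * G = G * cfc (fun t : ℝ => t) H * G := by rw [cfc_id' ℝ H]
    rw [this, hG, ← cfc_mul _ _ H (hc _) (hc _), ← cfc_mul _ _ H (hc _) (hc _)]
    refine cfc_congr fun t ht => ?_
    have := hnn t ht
    by_cases h0 : t = 0
    · simp [h0]
    · have : √t ≠ 0 := by positivity
      simp only [h0, if_false]
      field_simp
      exact (Real.sq_sqrt (hnn t ht)).symm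
  have hp : (T * G)ᴴ * (T * G) = G * H * G := by
    rw [conjTranspose_mul, hGs, hHdef]; noncomm_ring
  have hidem : (G * H * G) * (G * H * G) = G * H * G := by
    rw [hGHG, ← cfc_mul _ _ H (hc _) (hc _)]
    exact cfc_congr fun t _ => by by_cases h0 : t = 0 <;> simp [h0]
  have hHp : H * (G * H * G) = H := by
    rw [hGHG]
    nth_rw 1 3 [← cfc_id' ℝ H]
    rw [← cfc_mul _ _ H (hc _) (hc _)]
    exact cfc_congr fun t _ => by by_cases h0 : t = 0 <;> simp [h0]
  refine ⟨G, fun x hx => hH.commute_cfc hx _, ?_, fun h => ?_⟩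
  · rw [← sub_eq_zero, ← conjTranspose_mul_self_eq_zero, mul_assoc, hp]
    have hps : (G * H * G)ᴴ = G * H * G := by rw [← hp]; exact isHermitian_conjTranspose_mul_self _
    have : T * G * (G * H * G) - T * G = T * G * (G * H * G - 1) := by noncomm_ring
    rw [this, conjTranspose_mul, conjTranspose_sub, hps, conjTranspose_one, mul_assoc,
      ← mul_assoc (T * G)ᴴ, hp, mul_sub, hidem, mul_one, sub_self, mul_zero]
  · rw [← conjTranspose_mul_self_eq_zero, ← hHdef, ← hHp, ← hp, h, mul_zero, mul_zero]

variable (D : StarSubalgebra ℝ (Matrix n n ℝ × Matrix n n ℝ))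

theorem conjTranspose_intertwiner {T : Matrix n n ℝ} (hT : ∀ p ∈ D, T * p.1 = p.2 * T) :
    ∀ p ∈ D, Tᴴ * p.2 = p.1 * Tᴴ := fun p hp => by
  simpa only [conjTranspose_mul, Prod.fst_star, Prod.snd_star, star_eq_conjTranspose,
    conjTranspose_conjTranspose] using (congrArg conjTranspose (hT _ (star_mem hp))).symm

/-- If the two projections of a real star algebra of pairs of matrices have equal traces after
compression to a nonzero subrepresentation on each side, then there is a nonzero intertwiner. -/
theorem exists_intertwiner_ne_zero {e f : Matrix n n ℝ}
    (hes : e.IsHermitian) (hee : e * e = e) (hfs : f.IsHermitian) (hff : f * f = f)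
    (hec : ∀ p ∈ D, p.1 * e = e * p.1) (hfc : ∀ p ∈ D, p.2 * f = f * p.2)
    (htr : ∀ p ∈ D, (p.1 * e).trace = (p.2 * f).trace) (he0 : e ≠ 0) :
    ∃ T : Matrix n n ℝ, T ≠ 0 ∧ T * e = T ∧ f * T = T ∧ ∀ p ∈ D, T * p.1 = p.2 * T := by
  obtain ⟨k, b, hbK, hb⟩ := exists_trace_expansion
    (D.toSubalgebra.toSubmodule.map
      ((LinearMap.mulRight ℝ e).comp (LinearMap.fst ℝ (Matrix n n ℝ) (Matrix n n ℝ))))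
  have hex : ∀ i, ∃ p ∈ D, p.1 * e = b i := fun i => by simpa using hbK i
  choose q hqD hqb using hex
  have hb1 : ∀ p ∈ D, p.1 * e = ∑ i, ((b i)ᴴ * (p.1 * e)).trace • b i :=
    fun p hp => hb _ ⟨p, hp, rfl⟩
  have hzero : ∀ p ∈ D, p.1 * e = 0 → p.2 * f = 0 := by
    intro p hp h
    have h1 := htr (star p * p) (mul_mem (star_mem hp) hp)
    simp only [Prod.fst_mul, Prod.snd_mul, Prod.fst_star, Prod.snd_star, mul_assoc, h,
      mul_zero, trace_zero] at h1
    rw [← trace_conjTranspose_mul_self_eq_zero_iff, conjTranspose_mul, hfs.eq, mul_assoc,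
      trace_mul_comm, mul_assoc, mul_assoc, hff]
    exact h1.symm
  have hb2 : ∀ p ∈ D, p.2 * f = ∑ i, ((b i)ᴴ * (p.1 * e)).trace • ((q i).2 * f) := by
    intro p hp
    have hmem : p - ∑ i, ((b i)ᴴ * (p.1 * e)).trace • q i ∈ D :=
      sub_mem hp (sum_mem fun i _ => SMulMemClass.smul_mem _ (hqD i))
    have := hzero _ hmem (by
      simp only [Prod.fst_sub, Prod.fst_sum, Prod.smul_fst, sub_mul, Finset.sum_mul, smul_mul_assoc,
        hqb]
      rw [← hb1 p hp, sub_self])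
    simpa [sub_mul, Finset.sum_mul, sub_eq_zero, Prod.snd_sum] using this
  let T (Z : Matrix n n ℝ) : Matrix n n ℝ := ∑ i, (q i).2 * f * Z * (b i)ᴴ
  have hT : ∀ Z, ∀ p ∈ D, T Z * p.1 = p.2 * T Z := by
    intro Z p hp
    have hl : ∀ i, (b i)ᴴ * p.1 = ∑ j, ((b i)ᴴ * p.1 * b j).trace • (b j)ᴴ := by
      intro i
      have := congrArg conjTranspose (hb1 (star p * q i) (mul_mem (star_mem hp) (hqD i)))
      simp only [Prod.fst_mul, Prod.fst_star, mul_assoc, hqb, star_eq_conjTranspose,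
        conjTranspose_mul, conjTranspose_conjTranspose, conjTranspose_sum, conjTranspose_smul,
        star_trivial] at this
      refine this.trans (Finset.sum_congr rfl fun j _ => ?_)
      rw [← star_trivial (trace _), ← trace_conjTranspose]
      simp [mul_assoc]
    have hr : ∀ i, p.2 * ((q i).2 * f) = ∑ j, ((b j)ᴴ * p.1 * b i).trace • ((q j).2 * f) := by
      intro i
      simpa [mul_assoc, hqb] using hb2 (p * q i) (mul_mem hp (hqD i))
    simp only [T, Finset.sum_mul, Finset.mul_sum]
    calc ∑ i, (q i).2 * f * Z * (b i)ᴴ * p.1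
        = ∑ i, ∑ j, ((b i)ᴴ * p.1 * b j).trace • ((q i).2 * f * Z * (b j)ᴴ) := by
          refine Finset.sum_congr rfl fun i _ => ?_
          rw [mul_assoc]
          refine (congrArg _ (hl i)).trans ?_
          rw [Finset.mul_sum]
          exact Finset.sum_congr rfl fun j _ => mul_smul_comm _ _ _
      _ = ∑ j, ∑ i, ((b i)ᴴ * p.1 * b j).trace • ((q i).2 * f * Z * (b j)ᴴ) := Finset.sum_comm
      _ = ∑ j, p.2 * ((q j).2 * f * Z * (b j)ᴴ) := by
          refine Finset.sum_congr rfl fun j _ => ?_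
          rw [← mul_assoc, ← mul_assoc p.2, hr, Finset.sum_mul, Finset.sum_mul]
          simp
  by_contra! hno
  have hT0 : ∀ Z, T Z = 0 := by
    intro Z
    by_contra hne
    obtain ⟨p, hp, hpT⟩ := hno (T Z) hne (by
      simp only [T, Finset.sum_mul, mul_assoc]
      refine Finset.sum_congr rfl fun i _ => ?_
      have := hec _ (star_mem (hqD i))
      rw [Prod.fst_star, star_eq_conjTranspose] at this
      rw [← hqb, conjTranspose_mul, hes.eq, ← this, mul_assoc, hee]) (by
      simp only [T, Finset.mul_sum]
      refine Finset.sum_congr rfl fun i _ => ?_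
      simp only [← mul_assoc]
      rw [← hfc _ (hqD i), mul_assoc _ f f, hff])
    exact hpT (hT Z p hp)
  have hsum : ∑ i, (b i).trace * (b i).trace = 0 := by
    have h0 : ∀ a c, ∑ i, ((q i).2 * f) a a * (b i) c c = 0 := by
      intro a c
      have := congrFun (congrFun (hT0 (single a c 1)) a) c
      simpa [T, sum_apply, mul_apply, single_apply, ite_and, Finset.sum_ite_eq] using this
    have htb : ∀ i, (b i).trace = ((q i).2 * f).trace := fun i => by rw [← hqb, htr _ (hqD i)]
    calc ∑ i, (b i).trace * (b i).trace
        = ∑ i, ∑ a, ∑ c, ((q i).2 * f) a a * (b i) c c := by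
          refine Finset.sum_congr rfl fun i _ => ?_
          nth_rw 1 [htb]
          simp only [trace, diag_apply, Finset.sum_mul_sum]
      _ = 0 := by
          rw [Finset.sum_comm]
          refine Finset.sum_eq_zero fun a _ => ?_
          rw [Finset.sum_comm]
          exact Finset.sum_eq_zero fun c _ => h0 a c
  have hbt : ∀ i, (b i).trace = 0 := fun i => by
    simpa using (Finset.sum_eq_zero_iff_of_nonneg fun i _ => mul_self_nonneg (b i).trace).1 hsum i
      (Finset.mem_univ i)
  refine he0 (eq_zero_of_isIdempotentElem_of_trace_eq_zero hes hee ?_)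
  have := congrArg trace (hb1 1 (one_mem D))
  simpa [trace_sum, hbt] using this

/-- Equality of compressed traces yields a partial isometry intertwining the two projections of a
real star algebra of pairs of matrices. -/
theorem exists_partialIsometry_intertwiner (k : ℕ) : ∀ {e f : Matrix n n ℝ},
    e.IsHermitian → e * e = e → f.IsHermitian → f * f = f →
    (∀ p ∈ D, p.1 * e = e * p.1) → (∀ p ∈ D, p.2 * f = f * p.2) →
    (∀ p ∈ D, (p.1 * e).trace = (p.2 * f).trace) → e.trace = k →
    ∃ W : Matrix n n ℝ, Wᴴ * W = e ∧ W * Wᴴ = f ∧ ∀ p ∈ D, W * p.1 = p.2 * W := by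
  induction k using Nat.strong_induction_on with
  | _ k ih =>
  intro e f hes hee hfs hff hec hfc htr hk
  by_cases he0 : e = 0
  · refine ⟨0, by simp [he0], ?_, by simp⟩
    have := htr 1 (one_mem D)
    rw [eq_zero_of_isIdempotentElem_of_trace_eq_zero hfs hff (by simpa [he0] using this.symm)]
    simp
  obtain ⟨T, hT0, hTe, hfT, hT⟩ :=
    exists_intertwiner_ne_zero D hes hee hfs hff hec hfc htr he0
  have hT' : ∀ p ∈ D, Tᴴ * p.2 = p.1 * Tᴴ := conjTranspose_intertwiner D hT
  obtain ⟨G, hG, hW, hW0⟩ := exists_partialIsometry T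
  have hGD : ∀ p ∈ D, G * p.1 = p.1 * G := fun p hp => hG _ (by
    rw [Commute, SemiconjBy, mul_assoc, hT p hp, ← mul_assoc, hT' p hp, mul_assoc])
  have hGe : G * e = e * G := hG _ (by
    have := congrArg conjTranspose hTe
    rw [conjTranspose_mul, hes.eq] at this
    rw [Commute, SemiconjBy, mul_assoc, hTe, ← mul_assoc, this])
  have hWe : T * G * e = T * G := by rw [mul_assoc, hGe, ← mul_assoc, hTe]
  have hfW : f * (T * G) = T * G := by rw [← mul_assoc, hfT]
  have hWD : ∀ p ∈ D, T * G * p.1 = p.2 * (T * G) := fun p hp => by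
    rw [mul_assoc, hGD p hp, ← mul_assoc, hT p hp, mul_assoc]
  have hWne : T * G ≠ 0 := fun h => hT0 (hW0 h)
  generalize T * G = W at hW hWe hfW hWD hWne
  have hWD' : ∀ p ∈ D, Wᴴ * p.2 = p.1 * Wᴴ := conjTranspose_intertwiner D hWD
  have heW : e * Wᴴ = Wᴴ := by
    simpa only [conjTranspose_mul, hes.eq] using congrArg conjTranspose hWe
  have hWf : Wᴴ * f = Wᴴ := by
    simpa only [conjTranspose_mul, hfs.eq] using congrArg conjTranspose hfW
  have hW' : Wᴴ * W * Wᴴ = Wᴴ := by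
    simpa [mul_assoc] using congrArg conjTranspose hW
  have hps : (Wᴴ * W).IsHermitian := isHermitian_conjTranspose_mul_self W
  have hpp : Wᴴ * W * (Wᴴ * W) = Wᴴ * W := by rw [← mul_assoc, hW']
  have hes' := hes.sub hps
  have hfs' := hfs.sub (isHermitian_mul_conjTranspose_self W)
  have hee' : (e - Wᴴ * W) * (e - Wᴴ * W) = e - Wᴴ * W := by
    rw [sub_mul, mul_sub, mul_sub, hpp, hee, ← mul_assoc e, heW, mul_assoc, hWe]; simp
  have hff' : (f - W * Wᴴ) * (f - W * Wᴴ) = f - W * Wᴴ := by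
    rw [sub_mul, mul_sub, mul_sub, ← mul_assoc (W * Wᴴ) W, hW, hff,
      ← mul_assoc f, hfW, mul_assoc, hWf]
    simp
  obtain ⟨a, ha⟩ := exists_nat_trace_eq_of_isIdempotentElem hpp
  obtain ⟨c, hc⟩ := exists_nat_trace_eq_of_isIdempotentElem hee'
  have ha0 : a ≠ 0 := by
    rintro rfl
    exact hWne (trace_conjTranspose_mul_self_eq_zero_iff.1 (by simpa using ha))
  have hck : c < k := by
    rw [trace_sub, hk, ha] at hc
    have : (k : ℝ) = a + c := by linarith
    have : k = a + c := by exact_mod_cast this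
    omega
  obtain ⟨X, hX1, hX2, hXD⟩ := ih c hck hes' hee' hfs' hff'
    (fun p hp => by
      rw [mul_sub, sub_mul, hec p hp, ← mul_assoc, ← hWD' p hp, mul_assoc, mul_assoc, hWD p hp])
    (fun p hp => by
      rw [mul_sub, sub_mul, hfc p hp, ← mul_assoc, ← hWD p hp, mul_assoc, mul_assoc, hWD' p hp])
    (fun p hp => by
      rw [mul_sub, mul_sub, trace_sub, trace_sub, htr p hp, ← mul_assoc, ← hWD' p hp, mul_assoc,
        trace_mul_comm Wᴴ, mul_assoc])
    hc
  have hWX : Wᴴ * X = 0 := by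
    rw [← self_mul_conjTranspose_eq_zero, conjTranspose_mul, conjTranspose_conjTranspose, mul_assoc,
      ← mul_assoc X, hX2, sub_mul, hfW, hW, sub_self, mul_zero]
  have hXW : Xᴴ * W = 0 := by simpa using congrArg conjTranspose hWX
  have hWX' : W * Xᴴ = 0 := by
    rw [← self_mul_conjTranspose_eq_zero, conjTranspose_mul, conjTranspose_conjTranspose, mul_assoc,
      ← mul_assoc Xᴴ, hX1, sub_mul, heW, hW', sub_self, mul_zero]
  have hXW' : X * Wᴴ = 0 := by simpa using congrArg conjTranspose hWX'
  refine ⟨W + X, ?_, ?_, fun p hp => ?_⟩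
  · rw [conjTranspose_add, add_mul, mul_add, mul_add, hWX, hXW, hX1]; abel
  · rw [conjTranspose_add, add_mul, mul_add, mul_add, hWX', hXW', hX2]; abel
  · rw [add_mul, mul_add, hWD p hp, hXD p hp]

/-- **Specht's theorem** for real star algebras: if the two projections of a star algebra of pairs
of real matrices have the same trace, they are orthogonally conjugate. -/
theorem exists_orthogonal_intertwiner (htr : ∀ p ∈ D, p.1.trace = p.2.trace) :
    ∃ U : Matrix n n ℝ, Uᴴ * U = 1 ∧ ∀ p ∈ D, U * p.1 = p.2 * U := by
  obtain ⟨U, hU, -, hUD⟩ := exists_partialIsometry_intertwiner D (Fintype.card n)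
    (e := 1) (f := 1) isHermitian_one (mul_one 1) isHermitian_one (mul_one 1)
    (by simp) (by simp) (by simpa using htr) (by simp)
  exact ⟨U, hU, hUD⟩

end StarSubalgebra

end Matrix

section Quiver

variable {V : Type} [Quiver V] (d : V → ℕ)

theorem pathMatrixR_comp (A : ∀ u v : V, (u ⟶ v) → Matrix (Fin (d v)) (Fin (d u)) ℝ)
    {u v w : V} (p : Path u v) (q : Path v w) :
    pathMatrixR d A (p.comp q) = pathMatrixR d A q * pathMatrixR d A p := by
  induction q with
  | nil => simp [pathMatrixR]
  | cons q e ih => simp [pathMatrixR, ih, Matrix.mul_assoc]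

theorem pathMatrixR_intertwine {A B : ∀ u v : V, (u ⟶ v) → Matrix (Fin (d v)) (Fin (d u)) ℝ}
    {U : ∀ v : V, Matrix (Fin (d v)) (Fin (d v)) ℝ}
    (hU : ∀ (u v : V) (e : u ⟶ v), U v * B u v e = A u v e * U u) {u v : V} (p : Path u v) :
    U v * pathMatrixR d B p = pathMatrixR d A p * U u := by
  induction p with
  | nil => simp [pathMatrixR]
  | cons p e ih =>
    rw [pathMatrixR, pathMatrixR, ← Matrix.mul_assoc, hU, Matrix.mul_assoc, ih, Matrix.mul_assoc]

/-- Orthogonal intertwiners preserve traces along closed paths. -/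
theorem trace_pathMatrixR_eq_of_intertwine
    {A B : ∀ u v : V, (u ⟶ v) → Matrix (Fin (d v)) (Fin (d u)) ℝ}
    {U : ∀ v : V, Matrix (Fin (d v)) (Fin (d v)) ℝ} (hU : ∀ v, (U v)ᵀ * U v = 1)
    (hUAB : ∀ (u v : V) (e : u ⟶ v), U v * B u v e = A u v e * U u) {u : V} (p : Path u u) :
    (pathMatrixR d A p).trace = (pathMatrixR d B p).trace := by
  rw [← Matrix.mul_one (pathMatrixR d A p), ← mul_eq_one_comm.1 (hU u), ← Matrix.mul_assoc,
    ← pathMatrixR_intertwine d hUAB, trace_mul_comm, ← Matrix.mul_assoc, hU, Matrix.one_mul]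

theorem pathMatrixR_reverse [HasReverse V]
    {A : ∀ u v : V, (u ⟶ v) → Matrix (Fin (d v)) (Fin (d u)) ℝ}
    (hA : ∀ (u v : V) (e : u ⟶ v), A v u (reverse e) = (A u v e)ᵀ) {u v : V} (p : Path u v) :
    pathMatrixR d A p.reverse = (pathMatrixR d A p)ᵀ := by
  induction p with
  | nil => simp [Path.reverse, pathMatrixR]
  | cons p e ih =>
    simp [Path.reverse, pathMatrixR_comp, ih, pathMatrixR, hA, Hom.toPath]

theorem doubledRepRT_reverse (A : ∀ u v : V, (u ⟶ v) → Matrix (Fin (d v)) (Fin (d u)) ℝ)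
    (u v : Symmetrify V) (e : u ⟶ v) :
    doubledRepRT d A v u (reverse e) = (doubledRepRT d A u v e)ᵀ := by
  rcases e with e | e
  · rfl
  · exact (transpose_transpose (A v u e)).symm

end Quiver

section BlockInclusion

variable {V : Type} (d : V → ℕ)

/-- The matrix of the inclusion of the `v`-th summand into the total space. -/
noncomputable def blockInclusion (v : V) : Matrix (Σ v, Fin (d v)) (Fin (d v)) ℝ :=
  open Classical in (1 : Matrix (Σ v, Fin (d v)) (Σ v, Fin (d v)) ℝ).submatrix id fun i => ⟨v, i⟩

variable [Fintype V]

theorem transpose_blockInclusion_mul_self (v : V) :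
    (blockInclusion d v)ᵀ * blockInclusion d v = 1 := by
  classical
  ext i j
  simp [blockInclusion, mul_apply, one_apply, eq_comm]

theorem transpose_blockInclusion_mul_of_ne {u v : V} (h : u ≠ v) :
    (blockInclusion d u)ᵀ * blockInclusion d v = 0 := by
  classical
  ext i j
  simp [blockInclusion, mul_apply, one_apply, h]

theorem sum_blockInclusion_mul_transpose [DecidableEq (Σ v, Fin (d v))] :
    ∑ v, blockInclusion d v * (blockInclusion d v)ᵀ = 1 := by
  classical
  ext ⟨v, i⟩ ⟨w, j⟩
  have (u : V) : (blockInclusion d u * (blockInclusion d u)ᵀ) ⟨v, i⟩ ⟨w, j⟩ =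
      if u = v then (1 : Matrix (Σ v, Fin (d v)) (Σ v, Fin (d v)) ℝ) ⟨v, i⟩ ⟨w, j⟩ else 0 := by
    split_ifs with h
    · subst h
      rw [mul_apply, Finset.sum_eq_single i]
      · simp [blockInclusion, one_apply, eq_comm]
      · intro k _ hk
        simp [blockInclusion, one_apply, hk.symm]
      · simp
    · simp [blockInclusion, mul_apply, one_apply, Ne.symm h]
  rw [Matrix.sum_apply, Finset.sum_congr rfl fun u _ => this u]
  simp [one_apply]

end BlockInclusion

section ReversiblePathAlgebra

variable {V : Type} [Quiver V] (d : V → ℕ)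
  (A B : ∀ u v : V, (u ⟶ v) → Matrix (Fin (d v)) (Fin (d u)) ℝ)

/-- The block matrix on the total space of a path. -/
noncomputable def pathBlock {u v : V} (p : Path u v) :
    Matrix (Σ v, Fin (d v)) (Σ v, Fin (d v)) ℝ :=
  blockInclusion d v * pathMatrixR d A p *
    (blockInclusion d u)ᵀ

theorem pathBlock_nil (v : V) :
    pathBlock d A (Path.nil : Path v v) = blockInclusion d v * (blockInclusion d v)ᵀ := by
  simp [pathBlock, pathMatrixR]

theorem pathBlock_reverse [HasReverse V] {A : ∀ u v : V, (u ⟶ v) → Matrix (Fin (d v)) (Fin (d u)) ℝ}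
    (hA : ∀ (u v : V) (e : u ⟶ v), A v u (reverse e) = (A u v e)ᵀ) {u v : V} (p : Path u v) :
    pathBlock d A p.reverse = (pathBlock d A p)ᵀ := by
  simp [pathBlock, pathMatrixR_reverse d hA, Matrix.mul_assoc]

variable [Fintype V]

theorem pathBlock_mul {u v w : V} (p : Path u v) (q : Path v w) :
    pathBlock d A q * pathBlock d A p = pathBlock d A (p.comp q) := by
  rw [pathBlock, pathBlock, pathBlock, pathMatrixR_comp, Matrix.mul_assoc, Matrix.mul_assoc,
    ← Matrix.mul_assoc (blockInclusion d v)ᵀ, ← Matrix.mul_assoc (blockInclusion d v)ᵀ,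
    transpose_blockInclusion_mul_self, Matrix.one_mul]
  simp only [Matrix.mul_assoc]

theorem pathBlock_mul_of_ne {u v v' w : V} (p : Path u v) (q : Path v' w)
    (h : v' ≠ v) : pathBlock d A q * pathBlock d A p = 0 := by
  rw [pathBlock, pathBlock, Matrix.mul_assoc, Matrix.mul_assoc,
    ← Matrix.mul_assoc (blockInclusion d v')ᵀ, ← Matrix.mul_assoc (blockInclusion d v')ᵀ,
    transpose_blockInclusion_mul_of_ne d h]
  simp

theorem trace_pathBlock {u : V} (p : Path u u) :
    (pathBlock d A p).trace =
      (pathMatrixR d A p).trace := by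
  rw [pathBlock, trace_mul_comm, ← Matrix.mul_assoc, transpose_blockInclusion_mul_self,
    Matrix.one_mul]

theorem trace_pathBlock_of_ne {u v : V} (p : Path u v) (h : u ≠ v) :
    (pathBlock d A p).trace = 0 := by
  rw [pathBlock, trace_mul_comm, ← Matrix.mul_assoc, transpose_blockInclusion_mul_of_ne d h,
    Matrix.zero_mul, trace_zero]

theorem transpose_blockInclusion_mul_pathBlock {u v : V} (p : Path u v) :
    (blockInclusion d v)ᵀ * pathBlock d A p * blockInclusion d u =
      pathMatrixR d A p := by
  rw [pathBlock, ← Matrix.mul_assoc, ← Matrix.mul_assoc, transpose_blockInclusion_mul_self,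
    Matrix.one_mul, Matrix.mul_assoc, transpose_blockInclusion_mul_self, Matrix.mul_one]

/-- The span of the pairs of block matrices of all paths, for representations sending reversed arrows
to transposed matrices. -/
noncomputable def reversiblePathAlgebra [HasReverse V] [DecidableEq (Σ v, Fin (d v))]
    (hA : ∀ (u v : V) (e : u ⟶ v), A v u (reverse e) = (A u v e)ᵀ)
    (hB : ∀ (u v : V) (e : u ⟶ v), B v u (reverse e) = (B u v e)ᵀ) :
    StarSubalgebra ℝ (Matrix (Σ v, Fin (d v)) (Σ v, Fin (d v)) ℝ ×
      Matrix (Σ v, Fin (d v)) (Σ v, Fin (d v)) ℝ) :=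
  let S := Submodule.span ℝ {x : Matrix (Σ v, Fin (d v)) (Σ v, Fin (d v)) ℝ ×
      Matrix (Σ v, Fin (d v)) (Σ v, Fin (d v)) ℝ |
    ∃ (u v : V) (p : Path u v), x = (pathBlock d A p, pathBlock d B p)}
  have hone : 1 ∈ S := by
    have : (1 : Matrix (Σ v, Fin (d v)) (Σ v, Fin (d v)) ℝ ×
        Matrix (Σ v, Fin (d v)) (Σ v, Fin (d v)) ℝ) =
        ∑ v : V, (pathBlock d A (Path.nil : Path v v),
          pathBlock d B (Path.nil : Path v v)) := by
      ext1 <;> simp only [Prod.fst_sum, Prod.snd_sum, pathBlock_nil] <;>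
        rw [sum_blockInclusion_mul_transpose] <;> rfl
    rw [this]
    exact sum_mem fun v _ => Submodule.subset_span ⟨v, v, Path.nil, rfl⟩
  { S.toSubalgebra hone (fun x y hx hy => by
      induction hx, hy using Submodule.span_induction₂ with
      | mem_mem x y hx hy =>
        obtain ⟨v', w, q, rfl⟩ := hx
        obtain ⟨u, v, p, rfl⟩ := hy
        rw [Prod.mk_mul_mk]
        by_cases h : v' = v
        · subst h
          rw [pathBlock_mul, pathBlock_mul]
          exact Submodule.subset_span ⟨_, _, _, rfl⟩
        · rw [pathBlock_mul_of_ne _ _ _ _ h, pathBlock_mul_of_ne _ _ _ _ h]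
          exact S.zero_mem
      | zero_left y hy => simp
      | zero_right x hx => simp
      | add_left x y z _ _ _ h₁ h₂ => rw [add_mul]; exact S.add_mem h₁ h₂
      | add_right x y z _ _ _ h₁ h₂ => rw [mul_add]; exact S.add_mem h₁ h₂
      | smul_left r x y _ _ h => rw [smul_mul_assoc]; exact S.smul_mem r h
      | smul_right r x y _ _ h => rw [mul_smul_comm]; exact S.smul_mem r h) with
    star_mem' := fun {x} hx => by
      change star x ∈ S
      replace hx : x ∈ S := hx
      induction hx using Submodule.span_induction with
      | mem x hx =>
        obtain ⟨u, v, p, rfl⟩ := hx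
        refine Submodule.subset_span ⟨v, u, p.reverse, ?_⟩
        rw [pathBlock_reverse d hA, pathBlock_reverse d hB]
        rfl
      | zero => simp
      | add x y _ _ hx hy => rw [star_add]; exact S.add_mem hx hy
      | smul r x _ hx => rw [star_smul]; exact S.smul_mem _ hx }

variable [HasReverse V] [DecidableEq (Σ v, Fin (d v))]
  (hA : ∀ (u v : V) (e : u ⟶ v), A v u (reverse e) = (A u v e)ᵀ)
  (hB : ∀ (u v : V) (e : u ⟶ v), B v u (reverse e) = (B u v e)ᵀ)

theorem pathBlock_mem_reversiblePathAlgebra {u v : V} (p : Path u v) :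
    (pathBlock d A p, pathBlock d B p) ∈ reversiblePathAlgebra d A B hA hB :=
  Submodule.subset_span ⟨u, v, p, rfl⟩

theorem trace_eq_of_mem_reversiblePathAlgebra
    (h : ∀ (u : V) (p : Path u u), 0 < p.length →
      (pathMatrixR d A p).trace =
      (pathMatrixR d B p).trace) :
    ∀ x ∈ reversiblePathAlgebra d A B hA hB, x.1.trace = x.2.trace := by
  intro x hx
  refine Submodule.span_induction (p := fun x _ => x.1.trace = x.2.trace) ?_ ?_ ?_ ?_ hx
  · rintro _ ⟨u, v, p, rfl⟩
    by_cases huv : u = v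
    · subst huv
      by_cases hp : p.length = 0
      · rw [Path.eq_nil_of_length_zero p hp, pathBlock_nil, pathBlock_nil]
      · rw [trace_pathBlock, trace_pathBlock, h u p (Nat.pos_of_ne_zero hp)]
    · rw [trace_pathBlock_of_ne _ _ _ huv, trace_pathBlock_of_ne _ _ _ huv]
  · rfl
  · intro x y _ _ hx hy
    simp [hx, hy]
  · intro r x _ hx
    simp [hx]

end ReversiblePathAlgebra

/-- Specht's criterion for a quiver with reversed arrows: equal traces along closed paths give an
orthogonal isometry. -/
theorem exists_orthogonal_intertwiner_of_trace_eq
    {V : Type} [Quiver V] [Fintype V] [HasReverse V] (d : V → ℕ)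
    {A B : ∀ u v : V, (u ⟶ v) → Matrix (Fin (d v)) (Fin (d u)) ℝ}
    (hA : ∀ (u v : V) (e : u ⟶ v), A v u (reverse e) = (A u v e)ᵀ)
    (hB : ∀ (u v : V) (e : u ⟶ v), B v u (reverse e) = (B u v e)ᵀ)
    (h : ∀ (u : V) (p : Path u u), 0 < p.length →
      (pathMatrixR d A p).trace = (pathMatrixR d B p).trace) :
    ∃ U : ∀ v : V, Matrix (Fin (d v)) (Fin (d v)) ℝ, (∀ v, (U v)ᵀ * U v = 1) ∧
      ∀ (u v : V) (e : u ⟶ v), U v * A u v e = B u v e * U u := by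
  classical
  obtain ⟨U, hU, hUD⟩ := exists_orthogonal_intertwiner _
    (trace_eq_of_mem_reversiblePathAlgebra d A B hA hB h)
  rw [conjTranspose_eq_transpose_of_trivial] at hU
  have hcomm (v : V) : U * (blockInclusion d v * (blockInclusion d v)ᵀ) =
      blockInclusion d v * (blockInclusion d v)ᵀ * U := by
    have := hUD _ (pathBlock_mem_reversiblePathAlgebra d A B hA hB
      (Path.nil : Path v v))
    rwa [pathBlock_nil, pathBlock_nil] at this
  have hincl (v : V) : U * blockInclusion d v =
      blockInclusion d v * ((blockInclusion d v)ᵀ * U * blockInclusion d v) := by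
    rw [← Matrix.mul_assoc, ← Matrix.mul_assoc, ← hcomm, Matrix.mul_assoc, Matrix.mul_assoc,
      transpose_blockInclusion_mul_self, Matrix.mul_one]
  have hproj (v : V) : (blockInclusion d v)ᵀ * U =
      (blockInclusion d v)ᵀ * U * blockInclusion d v * (blockInclusion d v)ᵀ := by
    rw [Matrix.mul_assoc, Matrix.mul_assoc, hcomm, ← Matrix.mul_assoc, ← Matrix.mul_assoc,
      transpose_blockInclusion_mul_self, Matrix.one_mul]
  set W : ∀ v : V, Matrix (Fin (d v)) (Fin (d v)) ℝ :=
    fun v => (blockInclusion d v)ᵀ * U * blockInclusion d v with hWdef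
  have hW (v : V) : (W v)ᵀ * W v = 1 := by
    have : (W v)ᵀ = (U * blockInclusion d v)ᵀ * blockInclusion d v := by
      simp [hWdef, Matrix.mul_assoc]
    rw [this, Matrix.mul_assoc, ← hincl, transpose_mul, Matrix.mul_assoc, ← Matrix.mul_assoc Uᵀ,
      hU, Matrix.one_mul, transpose_blockInclusion_mul_self]
  refine ⟨W, hW, fun u v e => ?_⟩
  have hpath (C : ∀ u v : V, (u ⟶ v) → Matrix (Fin (d v)) (Fin (d u)) ℝ) :
      pathMatrixR d C (Hom.toPath e) = C u v e := by simp [Hom.toPath, pathMatrixR]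
  have hUp := congrArg (fun X => (blockInclusion d v)ᵀ * X * blockInclusion d u)
    (hUD _ (pathBlock_mem_reversiblePathAlgebra d A B hA hB (Hom.toPath e)))
  rw [← hpath A, ← hpath B, ← transpose_blockInclusion_mul_pathBlock,
    ← transpose_blockInclusion_mul_pathBlock, ← Matrix.mul_assoc, ← Matrix.mul_assoc, ← hproj,
    Matrix.mul_assoc _ (blockInclusion d u), ← hincl]
  simpa only [Matrix.mul_assoc] using hUp

/-- **Specht's criterion for real matrix representations of a quiver.**  Two real matrix
representations `A`, `B` of the same dimension `d` of a quiver with finitely many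
vertices and arrows are real orthogonally isometric iff the traces of all oriented cycles
(closed directed walks of positive length) in the doubled quiver coincide for the induced
representations `Ã`, `B̃` (which assign the transposed matrices to the reversed
arrows). -/
theorem matrixRep_realOrthogonally_isometric_iff_traces {V : Type} [Fintype V] [Quiver V]
    [∀ u v : V, Fintype (u ⟶ v)] (d : V → ℕ)
    (A B : ∀ u v : V, (u ⟶ v) → Matrix (Fin (d v)) (Fin (d u)) ℝ) :
    (∃ U : ∀ v : V, Matrix (Fin (d v)) (Fin (d v)) ℝ,
      (∀ v : V, (U v)ᵀ * U v = 1) ∧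
      ∀ (u v : V) (e : u ⟶ v), B u v e = (U v)⁻¹ * A u v e * U u) ↔
    (∀ (u : Symmetrify V) (p : Path u u), 0 < p.length →
      (pathMatrixR (V := Symmetrify V) d (doubledRepRT d A) p).trace =
      (pathMatrixR (V := Symmetrify V) d (doubledRepRT d B) p).trace) := by
  constructor
  · rintro ⟨U, hU, hB⟩ u p -
    have hinv (v : V) : (U v)⁻¹ = (U v)ᵀ := inv_eq_left_inv (hU v)
    have hUB (u v : V) (e : u ⟶ v) : U v * B u v e = A u v e * U u := by
      rw [hB, hinv, Matrix.mul_assoc, ← Matrix.mul_assoc, mul_eq_one_comm.1 (hU v), Matrix.one_mul]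
    have hUBt (u v : V) (e : u ⟶ v) : U u * (B u v e)ᵀ = (A u v e)ᵀ * U v := by
      rw [hB, hinv, transpose_mul, transpose_mul, transpose_transpose, ← Matrix.mul_assoc,
        mul_eq_one_comm.1 (hU u), Matrix.one_mul]
    refine trace_pathMatrixR_eq_of_intertwine (V := Symmetrify V) d (U := U) hU (fun u v e => ?_) p
    rcases e with e | e
    · exact hUB u v e
    · exact hUBt v u e
  · intro h
    have : Fintype (Symmetrify V) := inferInstanceAs (Fintype V)
    obtain ⟨U, hU, hUAB⟩ := exists_orthogonal_intertwiner_of_trace_eq (V := Symmetrify V) d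
      (doubledRepRT_reverse d A) (doubledRepRT_reverse d B) h
    refine ⟨fun v => (U v)ᵀ, fun v => ?_, fun u v e => ?_⟩
    · rw [transpose_transpose]
      exact mul_eq_one_comm.1 (hU v)
    · have hU' (v : V) : U v * (U v)ᵀ = 1 := mul_eq_one_comm.1 (hU v)
      have hUe : U v * A u v e = B u v e * U u := hUAB u v (Sum.inl e)
      rw [inv_eq_left_inv (hU' v), hUe, Matrix.mul_assoc, hU', Matrix.mul_one]
end

section
/- Let A₁,…,A_k and B₁,…,B_k (k ≥ 1) be complex matrices with m rows, where A_i and B_i have n_i columns for each i. If trace((A_{i₁}ᴴA_{i₁})···(A_{i_ℓ}ᴴA_{i_ℓ})) = trace((B_{i₁}ᴴB_{i₁})···(B_{i_ℓ}ᴴB_{i_ℓ})) for every sequence i₁,…,i_ℓ of indices in {1,…,k} with 1 ≤ ℓ ≤ (3(m + n₁ + ⋯ + n_k))², then there exist unitary matrices U (m×m) and V₁,…,V_k (V_i of size n_i×n_i) such that UA_iV_i = B_i for every i = 1,…,k. -/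
open Matrix

section Bicommutant

open scoped ComplexOrder

variable {ι : Type*} [Fintype ι]

/-- A Frobenius-orthonormal basis of a subspace of matrices. -/
lemma exists_frobenius_orthonormalBasis (W : Submodule ℂ (Matrix ι ι ℂ)) :
    ∃ (r : ℕ) (e : Fin r → Matrix ι ι ℂ), (∀ j, e j ∈ W) ∧
      ∀ X ∈ W, X = ∑ j, (star (e j) * X).trace • e j := by
  let L : EuclideanSpace ℂ (ι × ι) ≃ₗ[ℂ] Matrix ι ι ℂ :=
    (WithLp.linearEquiv 2 ℂ (ι × ι → ℂ)).trans (LinearEquiv.curry ℂ ℂ ι ι)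
  have hL : ∀ x y, inner ℂ x y = (star (L x) * L y).trace := by
    intro x y
    have hLa : ∀ x i j, L x i j = x (i, j) := fun _ _ _ => rfl
    rw [star_eq_conjTranspose, Matrix.trace, PiLp.inner_apply, Fintype.sum_prod_type,
      Finset.sum_comm]
    simp [hLa, Matrix.mul_apply, mul_comm]
  let b := stdOrthonormalBasis ℂ (W.comap L.toLinearMap)
  refine ⟨_, fun j => L (b j), fun j => (b j).2, fun X hX => ?_⟩
  have h := b.sum_repr' ⟨L.symm X, by simpa using hX⟩
  have h' := congrArg (fun z : W.comap L.toLinearMap => L z) h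
  simp only [Submodule.coe_sum, Submodule.coe_smul, map_sum, map_smul, Submodule.coe_inner, hL,
    LinearEquiv.apply_symm_apply] at h'
  exact h'.symm

lemma eq_zero_of_star_of_sq_of_trace {P : Matrix ι ι ℂ} (hs : star P = P) (hP : P * P = P)
    (ht : P.trace = 0) : P = 0 := by
  rw [← hP] at ht
  nth_rw 1 [← hs] at ht
  exact Matrix.trace_conjTranspose_mul_self_eq_zero_iff.1 ht

variable [DecidableEq ι]

/-- The square root of the pseudo-inverse of a positive semidefinite matrix. -/
lemma exists_pseudoInverse_sqrt {H : Matrix ι ι ℂ} (hH : H.PosSemidef) :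
    ∃ g : Matrix ι ι ℂ, star g = g ∧ (∀ b, Commute H b → Commute g b) ∧
      g * g * H * g = g ∧ H * g * g * H = H := by
  have hs : IsSelfAdjoint H := hH.1
  have hc : ∀ f : ℝ → ℝ, ContinuousOn f (spectrum ℝ H) := fun f =>
    (Matrix.finite_real_spectrum (A := H)).continuousOn f
  have hpos : ∀ x ∈ spectrum ℝ H, 0 ≤ x := by
    intro x hx
    rw [hH.1.spectrum_real_eq_range_eigenvalues] at hx
    obtain ⟨i, rfl⟩ := hx
    exact hH.eigenvalues_nonneg i
  set g := cfc (fun x : ℝ => (√x)⁻¹) H with hg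
  have hgg : g * g * H = cfc (fun x : ℝ => (√x)⁻¹ * (√x)⁻¹ * x) H := by
    rw [cfc_mul _ _ H (hc _) (hc _), cfc_mul _ _ H (hc _) (hc _), cfc_id' ℝ H hs]
  have hcomm : ∀ b, Commute H b → Commute g b := fun b hb =>
    hb.cfc (by rw [hs.star_eq]; exact hb) _
  refine ⟨g, cfc_predicate (R := ℝ) _ H, hcomm, ?_, ?_⟩
  · rw [hgg, hg, ← cfc_mul _ _ H (hc _) (hc _)]
    refine cfc_congr fun x hx => ?_
    rcases (hpos x hx).eq_or_lt with rfl | h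
    · simp
    · have := Real.sq_sqrt h.le
      have h2 := Real.sqrt_pos.2 h
      field_simp
      exact this.symm
  · have : H * g * g * H = H * (g * g * H) := by simp only [mul_assoc]
    rw [this, hgg]
    conv_lhs => enter [1]; rw [← cfc_id' ℝ H hs]
    rw [← cfc_mul _ _ H (hc _) (hc _)]
    conv_rhs => rw [← cfc_id' ℝ H hs]
    refine cfc_congr fun x hx => ?_
    rcases (hpos x hx).eq_or_lt with rfl | h
    · simp
    · have := Real.sq_sqrt h.le
      have h2 := Real.sqrt_pos.2 h
      field_simp
      exact this.symm

/-- A nonzero element of the commutant has a nonzero partial isometry as its polar part. -/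
lemma exists_partialIsometry_mem_centralizer (𝒜 : Set (Matrix ι ι ℂ))
    {P Q Ψ : Matrix ι ι ℂ} (hΨ : Ψ ∈ StarSubalgebra.centralizer ℂ 𝒜)
    (hP : star P = P) (hΨP : Ψ * P = Ψ) (hQΨ : Q * Ψ = Ψ) (h0 : Ψ ≠ 0) :
    ∃ R ∈ StarSubalgebra.centralizer ℂ 𝒜, R ≠ 0 ∧ R * star R * R = R ∧ R * P = R ∧
      Q * R = R := by
  obtain ⟨g, hg, hcomm, h1, h2⟩ :=
    exists_pseudoInverse_sqrt (Matrix.posSemidef_conjTranspose_mul_self Ψ)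
  rw [← star_eq_conjTranspose] at hcomm h1 h2
  have hPΨ : P * star Ψ = star Ψ := by rw [← hP, ← star_mul, hΨP]
  have hgP : g * P = P * g := hcomm P (by
    rw [Commute, SemiconjBy, mul_assoc, hΨP, ← mul_assoc, hPΨ])
  have hgC : g ∈ StarSubalgebra.centralizer ℂ 𝒜 := by
    have hH := mul_mem (star_mem hΨ) hΨ
    rw [StarSubalgebra.mem_centralizer_iff] at hH ⊢
    exact fun a ha => ⟨(hcomm a (hH a ha).1.symm).symm, (hcomm _ (hH a ha).2.symm).symm⟩
  refine ⟨Ψ * g, mul_mem hΨ hgC, ?_, ?_, ?_, ?_⟩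
  · intro h
    apply h0
    have : star Ψ * Ψ = 0 := by
      rw [← h2]
      have : star Ψ * Ψ * g * g * (star Ψ * Ψ) = star Ψ * (Ψ * g) * g * (star Ψ * Ψ) := by
        simp only [mul_assoc]
      rw [this, h]; simp
    rwa [star_eq_conjTranspose, Matrix.conjTranspose_mul_self_eq_zero] at this
  · calc Ψ * g * star (Ψ * g) * (Ψ * g) = Ψ * (g * g * (star Ψ * Ψ) * g) := by
          simp only [star_mul, hg, mul_assoc]
      _ = Ψ * g := by rw [h1]
  · rw [mul_assoc, hgP, ← mul_assoc, hΨP]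
  · rw [← mul_assoc, hQΨ]

/-- The twirl `∑ eⱼ C eⱼ*` over an orthonormal basis of a star algebra lies in its commutant. -/
lemma sum_mul_mul_star_mem_centralizer (𝒜 : StarSubalgebra ℂ (Matrix ι ι ℂ)) {r : ℕ}
    {e : Fin r → Matrix ι ι ℂ} (he : ∀ j, e j ∈ 𝒜)
    (hspan : ∀ X ∈ 𝒜, X = ∑ j, (star (e j) * X).trace • e j) (C : Matrix ι ι ℂ) :
    ∑ j, e j * C * star (e j) ∈ StarSubalgebra.centralizer ℂ (𝒜 : Set (Matrix ι ι ℂ)) := by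
  have key : ∀ x ∈ 𝒜, x * ∑ j, e j * C * star (e j) = (∑ j, e j * C * star (e j)) * x := by
    intro x hx
    have h1 : ∀ j, x * e j = ∑ k, (star (e k) * (x * e j)).trace • e k :=
      fun j => hspan _ (mul_mem hx (he j))
    have h2 : ∀ k, star (e k) * x = ∑ j, (star (e k) * (x * e j)).trace • star (e j) := by
      intro k
      have := congrArg star (hspan _ (mul_mem (star_mem hx) (he k)))
      rw [star_mul, star_star, star_sum] at this
      rw [this]
      refine Finset.sum_congr rfl fun j _ => ?_
      rw [star_smul]
      congr 1
      simp only [star_eq_conjTranspose]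
      rw [← Matrix.trace_conjTranspose]
      simp [mul_assoc]
    calc x * ∑ j, e j * C * star (e j)
        = ∑ j, ∑ k, (star (e k) * (x * e j)).trace • (e k * C * star (e j)) := by
          rw [Finset.mul_sum]
          refine Finset.sum_congr rfl fun j _ => ?_
          rw [← mul_assoc, ← mul_assoc, h1 j, Finset.sum_mul, Finset.sum_mul]
          simp only [smul_mul_assoc]
          rw [← h1 j]
      _ = (∑ j, e j * C * star (e j)) * x := by
          rw [Finset.sum_comm, Finset.sum_mul]
          refine Finset.sum_congr rfl fun k _ => ?_
          rw [mul_assoc _ (star (e k)), h2 k, Finset.mul_sum]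
          simp only [mul_smul_comm]
  rw [StarSubalgebra.mem_centralizer_iff]
  exact fun x hx => ⟨key x hx, key _ (star_mem hx)⟩

lemma sum_trace_mul_trace_eq_zero {r : ℕ} (M N : Fin r → Matrix ι ι ℂ)
    (h : ∀ C : Matrix ι ι ℂ, ∑ j, M j * C * N j = 0) :
    ∑ j, (M j).trace * (N j).trace = 0 := by
  have h1 : ∀ b c, ∑ j, M j b b * N j c c = 0 := by
    intro b c
    have := congrFun (congrFun (h (Matrix.single b c 1)) b) c
    simpa [Matrix.sum_apply, Matrix.mul_apply, Matrix.single_apply, Finset.sum_ite_eq,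
      ite_and] using this
  simp only [Matrix.trace, Matrix.diag, Finset.sum_mul_sum]
  rw [Finset.sum_comm]
  refine Finset.sum_eq_zero fun b _ => ?_
  rw [Finset.sum_comm]
  exact Finset.sum_eq_zero fun c _ => h1 b c

/-- Two projections in the commutant of a star algebra with the same nonzero character on it are
linked by a nonzero element of the commutant. -/
lemma exists_ne_zero_mem_centralizer (𝒜 : StarSubalgebra ℂ (Matrix ι ι ℂ)) {P Q : Matrix ι ι ℂ}
    (hP : P ∈ StarSubalgebra.centralizer ℂ (𝒜 : Set (Matrix ι ι ℂ)))
    (hQ : Q ∈ StarSubalgebra.centralizer ℂ (𝒜 : Set (Matrix ι ι ℂ)))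
    (hPs : star P = P) (hPP : P * P = P) (hQQ : Q * Q = Q) (hP0 : P ≠ 0)
    (htr : ∀ x ∈ 𝒜, (P * x).trace = (Q * x).trace) :
    ∃ Ψ ∈ StarSubalgebra.centralizer ℂ (𝒜 : Set (Matrix ι ι ℂ)),
      Ψ * P = Ψ ∧ Q * Ψ = Ψ ∧ Ψ ≠ 0 := by
  obtain ⟨r, e, he, hspan⟩ := exists_frobenius_orthonormalBasis 𝒜.toSubalgebra.toSubmodule
  by_contra! hno
  have hzero : ∀ C : Matrix ι ι ℂ, ∑ j, (Q * e j) * C * (star (e j) * P) = 0 := by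
    intro C
    have hC := sum_mul_mul_star_mem_centralizer 𝒜 he hspan C
    have := hno (Q * (∑ j, e j * C * star (e j)) * P) (mul_mem (mul_mem hQ hC) hP)
      (by rw [mul_assoc, hPP]) (by rw [← mul_assoc, ← mul_assoc, hQQ])
    rw [← this, Finset.mul_sum, Finset.sum_mul]
    simp only [mul_assoc]
  have hsum := sum_trace_mul_trace_eq_zero _ _ hzero
  have hsq : ∀ j, (P * e j).trace = 0 := by
    have h1 : ∀ j, (Q * e j).trace * (star (e j) * P).trace
        = ((Complex.normSq (P * e j).trace : ℝ) : ℂ) := by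
      intro j
      rw [← htr _ (he j), Complex.normSq_eq_conj_mul_self, mul_comm]
      congr 1
      rw [starRingEnd_apply, ← Matrix.trace_conjTranspose, ← star_eq_conjTranspose, star_mul, hPs]
    simp only [h1] at hsum
    rw [← Complex.ofReal_sum, Complex.ofReal_eq_zero,
      Finset.sum_eq_zero_iff_of_nonneg fun j _ => Complex.normSq_nonneg _] at hsum
    exact fun j => Complex.normSq_eq_zero.1 (hsum j (Finset.mem_univ j))
  apply hP0
  refine eq_zero_of_star_of_sq_of_trace hPs hPP ?_
  have h1 := hspan 1 (one_mem 𝒜)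
  rw [← mul_one P, h1, Finset.mul_sum, Matrix.trace_sum]
  refine Finset.sum_eq_zero fun j _ => ?_
  rw [mul_smul_comm, Matrix.trace_smul, hsq, smul_zero]

/-- Two projections in the commutant of a star algebra with the same character on it are
Murray–von Neumann equivalent in the commutant. -/
theorem exists_partialIsometry_mem_centralizer_of_trace_eq
    (𝒜 : StarSubalgebra ℂ (Matrix ι ι ℂ)) {E₁ E₂ : Matrix ι ι ℂ}
    (h₁ : E₁ ∈ StarSubalgebra.centralizer ℂ (𝒜 : Set (Matrix ι ι ℂ)))
    (h₂ : E₂ ∈ StarSubalgebra.centralizer ℂ (𝒜 : Set (Matrix ι ι ℂ)))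
    (hs₁ : star E₁ = E₁) (hs₂ : star E₂ = E₂) (hE₁ : E₁ * E₁ = E₁) (hE₂ : E₂ * E₂ = E₂)
    (htr : ∀ x ∈ 𝒜, (E₁ * x).trace = (E₂ * x).trace) :
    ∃ F ∈ StarSubalgebra.centralizer ℂ (𝒜 : Set (Matrix ι ι ℂ)),
      star F * F = E₁ ∧ F * star F = E₂ := by
  let 𝒮 : Set (Matrix ι ι ℂ) := {F | F ∈ StarSubalgebra.centralizer ℂ (𝒜 : Set (Matrix ι ι ℂ)) ∧
    F * star F * F = F ∧ F * E₁ = F ∧ E₂ * F = F}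
  have hne : 𝒮.Nonempty := ⟨0, zero_mem _, by simp, by simp, by simp⟩
  obtain ⟨F, ⟨hF, hFF, hF₁, hF₂⟩, hmin⟩ := (InvImage.wf (fun F : Matrix ι ι ℂ =>
    LinearMap.ker (Matrix.mulVecLin F)) wellFounded_lt).has_min 𝒮 hne
  have hFF₂ : F * (star F * F) = F := by rw [← mul_assoc, hFF]
  set P := E₁ - star F * F with hPdef
  set Q := E₂ - F * star F with hQdef
  have hPs : star P = P := by simp [hPdef, hs₁]
  have hQs : star Q = Q := by simp [hQdef, hs₂]
  have hFP : F * P = 0 := by rw [hPdef, mul_sub, hF₁, hFF₂, sub_self]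
  have hQF : Q * F = 0 := by rw [hQdef, sub_mul, hF₂, hFF, sub_self]
  have hPF : P * star F = 0 := by rw [← hPs, ← star_mul, hFP, star_zero]
  have hFQ : star F * Q = 0 := by rw [← hQs, ← star_mul, hQF, star_zero]
  have hE₁P : P * E₁ = P := by rw [hPdef, sub_mul, hE₁, mul_assoc, hF₁]
  have hE₂Q : E₂ * Q = Q := by rw [hQdef, mul_sub, hE₂, ← mul_assoc, hF₂]
  have hPP : P * P = P := by
    nth_rw 2 [hPdef]
    rw [mul_sub, hE₁P, ← mul_assoc, hPF, zero_mul, sub_zero]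
  have hQQ : Q * Q = Q := by
    nth_rw 1 [hQdef]
    rw [sub_mul, hE₂Q, mul_assoc, hFQ, mul_zero, sub_zero]
  have hPtr : ∀ x ∈ 𝒜, (P * x).trace = (Q * x).trace := by
    intro x hx
    rw [hPdef, hQdef, sub_mul, sub_mul, Matrix.trace_sub, Matrix.trace_sub, htr x hx]
    congr 1
    have hxF : x * F = F * x := ((StarSubalgebra.mem_centralizer_iff ℂ).1 hF x hx).1
    rw [mul_assoc, Matrix.trace_mul_comm, ← hxF, ← Matrix.trace_mul_comm x, mul_assoc]
  by_cases hP0 : P = 0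
  · have hQ0 : Q = 0 := by
      refine eq_zero_of_star_of_sq_of_trace hQs hQQ ?_
      have := hPtr 1 (one_mem 𝒜)
      rwa [hP0, zero_mul, Matrix.trace_zero, mul_one, eq_comm] at this
    exact ⟨F, hF, (sub_eq_zero.1 hP0).symm, (sub_eq_zero.1 hQ0).symm⟩
  exfalso
  have hPC : P ∈ StarSubalgebra.centralizer ℂ (𝒜 : Set (Matrix ι ι ℂ)) :=
    sub_mem h₁ (mul_mem (star_mem hF) hF)
  have hQC : Q ∈ StarSubalgebra.centralizer ℂ (𝒜 : Set (Matrix ι ι ℂ)) :=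
    sub_mem h₂ (mul_mem hF (star_mem hF))
  obtain ⟨Ψ, hΨ, hΨP, hQΨ, hΨ0⟩ := exists_ne_zero_mem_centralizer 𝒜 hPC hQC hPs hPP hQQ hP0 hPtr
  obtain ⟨R, hR, hR0, hRR, hRP, hQR⟩ :=
    exists_partialIsometry_mem_centralizer _ hΨ hPs hΨP hQΨ hΨ0
  have hFR : star F * R = 0 := by rw [← hQR, ← mul_assoc, hFQ, zero_mul]
  have hRF : R * star F = 0 := by rw [← hRP, mul_assoc, hPF, mul_zero]
  have hFR' : star R * F = 0 := by simpa using congrArg star hFR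
  have hRF' : F * star R = 0 := by simpa using congrArg star hRF
  refine hmin (F + R) ⟨add_mem hF hR, ?_, ?_, ?_⟩ ?_
  · have hsum : (F + R) * star (F + R) = F * star F + R * star R := by
      rw [star_add, mul_add, add_mul, add_mul, hRF, hRF', add_zero, zero_add]
    rw [hsum, mul_add, add_mul, add_mul, hFF, hRR, mul_assoc R, hFR', mul_zero, add_zero,
      mul_assoc F, hFR, mul_zero, zero_add]
  · rw [add_mul, hF₁, ← hRP, mul_assoc, hE₁P]
  · rw [mul_add, hF₂, ← hQR, ← mul_assoc, hE₂Q]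
  · have hle : ∀ v, (F + R) *ᵥ v = 0 → F *ᵥ v = 0 ∧ R *ᵥ v = 0 := by
      intro v hv
      have hF0 : F *ᵥ v = 0 := by
        have := congrArg (fun w => F *ᵥ (star F *ᵥ w)) hv
        simpa [Matrix.mulVec_mulVec, mul_add, hFR, ← mul_assoc, hFF] using this
      refine ⟨hF0, ?_⟩
      rwa [Matrix.add_mulVec, hF0, zero_add] at hv
    refine lt_of_le_of_ne (fun v hv => (hle v hv).1) fun heq => hR0 ?_
    have hRv : ∀ v, R *ᵥ v = 0 := by
      intro v
      have hmem : P *ᵥ v ∈ LinearMap.ker (Matrix.mulVecLin F) := by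
        simp [Matrix.mulVec_mulVec, hFP]
      replace hmem : P *ᵥ v ∈ LinearMap.ker (Matrix.mulVecLin (F + R)) := heq.ge hmem
      have := (hle _ hmem).2
      rwa [Matrix.mulVec_mulVec, hRP] at this
    exact Matrix.ext_of_mulVec_single fun i => by rw [hRv, Matrix.zero_mulVec]

end Bicommutant

/-- Words of length at most the dimension span the subalgebra generated by the letters. -/
lemma list_prod_mem_span_of_finrank {K R κ : Type*} [Field K] [Ring R] [Algebra K R]
    [FiniteDimensional K R] (Z : κ → R) (l : List κ) :
    (l.map Z).prod ∈ Submodule.span K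
      ((fun w : List κ => (w.map Z).prod) '' {w | w.length ≤ Module.finrank K R}) := by
  set W : ℕ → Submodule K R := fun L =>
    Submodule.span K ((fun w : List κ => (w.map Z).prod) '' {w | w.length ≤ L}) with hW
  have hmono : Monotone W := fun a b hab =>
    Submodule.span_mono (Set.image_mono fun w (hw : w.length ≤ a) => hw.trans hab)
  have hmul : ∀ L a x, x ∈ W L → Z a * x ∈ W (L + 1) := by
    intro L a x hx
    induction hx using Submodule.span_induction with
    | mem x hx =>
      obtain ⟨w, hw, rfl⟩ := hx
      exact Submodule.subset_span ⟨a :: w, Nat.succ_le_succ hw, by simp⟩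
    | zero => simp
    | add x y _ _ hx hy => rw [mul_add]; exact add_mem hx hy
    | smul c x _ hx => rw [mul_smul_comm]; exact Submodule.smul_mem _ _ hx
  obtain ⟨L, hL, hstab⟩ : ∃ L ≤ Module.finrank K R, W (L + 1) ≤ W L := by
    by_contra! h
    have hrank : ∀ L ≤ Module.finrank K R + 1, L ≤ Module.finrank K (W L) := by
      intro L
      induction L with
      | zero => simp
      | succ L ih =>
        intro hL
        have h1 := Submodule.finrank_lt_finrank_of_lt
          (lt_of_le_not_ge (hmono (Nat.le_add_right L 1)) (h L (by omega)))
        have h2 := ih (by omega)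
        omega
    have h1 := hrank _ le_rfl
    have h2 := Submodule.finrank_le (W (Module.finrank K R + 1))
    omega
  refine hmono hL ?_
  induction l with
  | nil => exact Submodule.subset_span ⟨[], Nat.zero_le _, rfl⟩
  | cons a l ih => simpa using hstab (hmul L a _ ih)

lemma list_map_fromBlocks_prod {κ m n R : Type*} [Fintype m] [Fintype n] [DecidableEq m]
    [DecidableEq n] [Semiring R] (S : κ → Matrix m m R) (T : κ → Matrix n n R) (l : List κ) :
    (l.map fun i => fromBlocks (S i) 0 0 (T i)).prod =
      fromBlocks (l.map S).prod 0 0 (l.map T).prod := by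
  induction l with
  | nil => simp
  | cons a l ih => simp [ih, fromBlocks_multiply]

/-- **Specht's criterion** for families of Hermitian matrices, with a quadratic bound on the length
of the words. -/
theorem exists_unitary_conj_of_trace_eq {κ m : Type*} [Fintype m] [DecidableEq m]
    (S T : κ → Matrix m m ℂ) (hS : ∀ i, (S i)ᴴ = S i) (hT : ∀ i, (T i)ᴴ = T i)
    (htr : ∀ l : List κ, l.length ≤ (2 * Fintype.card m) ^ 2 →
      (l.map S).prod.trace = (l.map T).prod.trace) :
    ∃ U : Matrix m m ℂ, Uᴴ * U = 1 ∧ ∀ i, U * S i = T i * U := by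
  set Z : κ → Matrix (m ⊕ m) (m ⊕ m) ℂ := fun i => fromBlocks (S i) 0 0 (T i) with hZ
  set E₁ : Matrix (m ⊕ m) (m ⊕ m) ℂ := fromBlocks 1 0 0 0 with hE₁
  set E₂ : Matrix (m ⊕ m) (m ⊕ m) ℂ := fromBlocks 0 0 0 1 with hE₂
  have hZs : ∀ i, star (Z i) = Z i := fun i => by
    simp [hZ, star_eq_conjTranspose, fromBlocks_conjTranspose, hS, hT]
  have hZstar : star (Set.range Z) = Set.range Z := by
    ext x
    simp only [Set.mem_star, Set.mem_range]
    refine exists_congr fun i => ?_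
    rw [← hZs i, star_inj, hZs i]
  let 𝒜 := StarAlgebra.adjoin ℂ (Set.range Z)
  have hcent : ∀ E, (∀ i, Z i * E = E * Z i) →
      E ∈ StarSubalgebra.centralizer ℂ (𝒜 : Set (Matrix (m ⊕ m) (m ⊕ m) ℂ)) := by
    intro E hE
    have h : 𝒜 ≤ StarSubalgebra.centralizer ℂ {E} := by
      refine StarAlgebra.adjoin_le ?_
      rintro _ ⟨i, rfl⟩
      rw [SetLike.mem_coe, StarSubalgebra.mem_centralizer_iff]
      rintro _ rfl
      refine ⟨(hE i).symm, ?_⟩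
      simpa [hZs] using congrArg star (hE i)
    have h' : ∀ x ∈ 𝒜, x * E = E * x := fun x hx =>
      ((StarSubalgebra.mem_centralizer_iff ℂ).1 (h hx) E rfl).1.symm
    rw [StarSubalgebra.mem_centralizer_iff]
    exact fun x hx => ⟨h' x hx, h' _ (star_mem hx)⟩
  have hfinrank : Module.finrank ℂ (Matrix (m ⊕ m) (m ⊕ m) ℂ) = (2 * Fintype.card m) ^ 2 := by
    rw [Module.finrank_matrix, Fintype.card_sum, Module.finrank_self]; ring
  have htrA : ∀ x ∈ 𝒜, (E₁ * x).trace = (E₂ * x).trace := by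
    intro x hx
    have hx' : x ∈ Submodule.span ℂ (Submonoid.closure (Set.range Z) : Set _) := by
      rw [← Algebra.adjoin_eq_span]
      have := StarAlgebra.adjoin_toSubalgebra ℂ (Set.range Z)
      rw [hZstar, Set.union_self] at this
      rw [← this]
      exact hx
    let φ : Matrix (m ⊕ m) (m ⊕ m) ℂ →ₗ[ℂ] ℂ :=
      traceLinearMap (m ⊕ m) ℂ ℂ ∘ₗ LinearMap.mulLeft ℂ (E₁ - E₂)
    have hφ : ∀ y, φ y = (E₁ * y).trace - (E₂ * y).trace := by
      intro y; simp [φ, sub_mul]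
    suffices Submodule.span ℂ (Submonoid.closure (Set.range Z) : Set _) ≤ LinearMap.ker φ by
      have := this hx'
      rw [LinearMap.mem_ker, hφ] at this
      exact sub_eq_zero.1 this
    rw [Submodule.span_le]
    intro y hy
    obtain ⟨l, hl, rfl⟩ := Submonoid.exists_list_of_mem_closure hy
    obtain ⟨w, rfl⟩ : l ∈ Set.range (List.map Z) := by
      rw [Set.range_list_map]; exact hl
    refine (Submodule.span_le (p := LinearMap.ker φ)).2 ?_
      (list_prod_mem_span_of_finrank (K := ℂ) Z w)
    rintro _ ⟨v, hv, rfl⟩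
    rw [Set.mem_ofPred_eq, hfinrank] at hv
    simp only [SetLike.mem_coe, LinearMap.mem_ker, hφ]
    rw [hZ, list_map_fromBlocks_prod]
    simp [hE₁, hE₂, fromBlocks_multiply, Matrix.trace, Fintype.sum_sum_type]
    simpa [sub_eq_zero, Matrix.trace] using htr v hv
  obtain ⟨F, hF, hF₁, hF₂⟩ := exists_partialIsometry_mem_centralizer_of_trace_eq 𝒜
    (hcent E₁ fun i => by simp [hZ, hE₁, fromBlocks_multiply])
    (hcent E₂ fun i => by simp [hZ, hE₂, fromBlocks_multiply])
    (by simp [hE₁, star_eq_conjTranspose, fromBlocks_conjTranspose])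
    (by simp [hE₂, star_eq_conjTranspose, fromBlocks_conjTranspose])
    (by simp [hE₁, fromBlocks_multiply]) (by simp [hE₂, fromBlocks_multiply]) htrA
  have hF0 : E₁ * F = 0 := by
    open scoped ComplexOrder in
    rw [← Matrix.self_mul_conjTranspose_eq_zero, ← star_eq_conjTranspose, star_mul,
      ← mul_assoc, mul_assoc E₁, hF₂]
    simp [hE₁, hE₂, fromBlocks_multiply]
  obtain ⟨a, b, c, d, rfl⟩ : ∃ a b c d, F = fromBlocks a b c d :=
    ⟨_, _, _, _, (fromBlocks_toBlocks F).symm⟩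
  refine ⟨c, ?_, fun i => ?_⟩
  · have ha : a = 0 := by
      rw [hE₁, fromBlocks_multiply, ← fromBlocks_zero, fromBlocks_inj] at hF0
      simpa using hF0.1
    have := congrArg toBlocks₁₁ hF₁
    simpa [hE₁, ha, star_eq_conjTranspose, fromBlocks_conjTranspose, fromBlocks_multiply] using this
  · have := ((StarSubalgebra.mem_centralizer_iff ℂ).1 hF (Z i)
      (StarAlgebra.subset_adjoin ℂ _ ⟨i, rfl⟩)).1
    simpa [hZ, fromBlocks_multiply] using (congrArg toBlocks₂₁ this).symm

/-- Matrices with the same Gram matrix of rows differ by a unitary factor on the right. -/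
lemma exists_unitary_mul_eq_of_mul_conjTranspose_eq {m n : Type*} [Fintype m] [Fintype n]
    [DecidableEq m] [DecidableEq n] (C D : Matrix m n ℂ) (h : C * Cᴴ = D * Dᴴ) :
    ∃ V : Matrix n n ℂ, Vᴴ * V = 1 ∧ C * V = D := by
  set f := Matrix.toEuclideanLin Cᴴ with hf
  set g := Matrix.toEuclideanLin Dᴴ with hg
  have hnorm : ∀ x, ‖g x‖ = ‖f x‖ := by
    have key : ∀ (M : Matrix m n ℂ) x, inner ℂ (toEuclideanLin Mᴴ x) (toEuclideanLin Mᴴ x) =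
        inner ℂ x (toEuclideanLin (M * Mᴴ) x) := by
      intro M x
      rw [toEuclideanLin_conjTranspose_eq_adjoint, LinearMap.adjoint_inner_left,
        ← toEuclideanLin_conjTranspose_eq_adjoint]
      simp [toLpLin_apply]
    intro x
    rw [@norm_eq_sqrt_re_inner ℂ, @norm_eq_sqrt_re_inner ℂ, hf, hg, key, key, h]
  obtain ⟨s, hs⟩ := f.rangeRestrict.exists_rightInverse_of_surjective f.range_rangeRestrict
  have hfs : ∀ y : LinearMap.range f, f (s y) = y := fun y =>
    congrArg Subtype.val (LinearMap.congr_fun hs y)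
  let L : LinearMap.range f →ₗᵢ[ℂ] EuclideanSpace ℂ n :=
    ⟨g ∘ₗ s, fun y => by rw [LinearMap.comp_apply, hnorm, hfs, Submodule.coe_norm]⟩
  have hL : ∀ x, L.extend (f x) = g x := by
    intro x
    have h1 := L.extend_apply ⟨f x, x, rfl⟩
    rw [h1]
    change g (s ⟨f x, x, rfl⟩) = g x
    rw [← sub_eq_zero, ← map_sub, ← norm_eq_zero, hnorm, map_sub, hfs, sub_self, norm_zero]
  set W := toEuclideanLin.symm L.extend.toLinearMap with hW
  have hWL : toEuclideanLin W = L.extend.toLinearMap := LinearEquiv.apply_symm_apply _ _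
  have hWC : W * Cᴴ = Dᴴ := by
    apply toEuclideanLin.injective
    ext1 x
    rw [← hg, ← hL x]
    change _ = L.extend.toLinearMap _
    rw [← hWL]
    simp [hf, toLpLin_apply]
  have hWW : Wᴴ * W = 1 := by
    apply toEuclideanLin.injective
    ext1 x
    refine ext_inner_left ℂ fun y => ?_
    have h1 : toEuclideanLin (Wᴴ * W) x = toEuclideanLin Wᴴ (toEuclideanLin W x) := by
      simp [toLpLin_apply]
    rw [h1, toEuclideanLin_conjTranspose_eq_adjoint, LinearMap.adjoint_inner_right, hWL]
    simp
  refine ⟨Wᴴ, ?_, ?_⟩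
  · rw [conjTranspose_conjTranspose]
    exact mul_eq_one_comm.1 hWW
  · simpa using congrArg conjTranspose hWC

lemma sum_path_eq_sum_list_prod {m R : Type*} [Fintype m] [DecidableEq m] [CommSemiring R] :
    ∀ (l : ℕ) (M : Fin l → Matrix m m R) (f : m → m → R),
      ∑ y : Fin (l + 1) → m, (∏ j : Fin l, M j (y j.castSucc) (y j.succ)) * f (y 0) (y (Fin.last l))
        = ∑ a, ∑ b, (List.ofFn M).prod a b * f a b := by
  intro l
  induction l with
  | zero =>
    intro M f
    rw [← (Equiv.funUnique (Fin 1) m).symm.sum_comp]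
    simp [Matrix.one_apply]
  | succ l ih =>
    intro M f
    rw [← (Fin.consEquiv fun _ => m).sum_comp, Fintype.sum_prod_type]
    refine Finset.sum_congr rfl fun a _ => ?_
    have := ih (fun j => M j.succ) (fun c b => M 0 a c * f a b)
    simp only [Fin.prod_univ_succ, Fin.consEquiv_apply, List.ofFn_succ, List.prod_cons,
      Matrix.mul_apply, Finset.sum_mul]
    rw [Finset.sum_comm] at this
    convert this using 1
    · refine Finset.sum_congr rfl fun z _ => ?_
      simp only [Fin.castSucc_zero, Fin.cons_zero, Fin.cons_succ, ← Fin.succ_castSucc,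
        ← Fin.succ_last]
      ring
    · refine Finset.sum_congr rfl fun b _ => Finset.sum_congr rfl fun c _ => ?_
      ring

lemma trace_list_ofFn_prod {m R : Type*} [Fintype m] [DecidableEq m] [CommSemiring R]
    (l : ℕ) (M : Fin (l + 1) → Matrix m m R) :
    (List.ofFn M).prod.trace = ∑ y : Fin (l + 1) → m, ∏ j, M j (y j) (y (j + 1)) := by
  simp only [Fin.prod_univ_castSucc, Fin.coeSucc_eq_succ, Fin.last_add_one]
  rw [sum_path_eq_sum_list_prod l (fun j => M j.castSucc) fun a b => M (Fin.last l) b a,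
    List.ofFn_succ', List.concat_eq_append, List.prod_append]
  simp [Matrix.trace, Matrix.mul_apply]

/-- The cyclic trace of a word in the rectangular Gram blocks `Aᵢᴴ Aⱼ` is the trace of the
corresponding word in the matrices `Aᵢ Aᵢᴴ`. -/
lemma trace_prod_mul_conjTranspose {κ m : Type*} [Fintype m] [DecidableEq m] {n : κ → Type*}
    [∀ i, Fintype (n i)] (A : ∀ i, Matrix m (n i) ℂ) (l : ℕ) (i : Fin (l + 1) → κ) :
    (List.ofFn fun j => A (i j) * (A (i j))ᴴ).prod.trace =
      ∑ x : ∀ j, n (i j), ∏ j, ((A (i j))ᴴ * A (i (j + 1))) (x j) (x (j + 1)) := by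
  rw [trace_list_ofFn_prod]
  simp only [Matrix.mul_apply, Finset.prod_univ_sum, Fintype.piFinset_univ]
  rw [Finset.sum_comm]
  refine Finset.sum_congr rfl fun x _ => ?_
  rw [← (Equiv.arrowCongr (Equiv.addRight (1 : Fin (l + 1))) (Equiv.refl m)).sum_comp]
  refine Finset.sum_congr rfl fun y _ => ?_
  simp only [Finset.prod_mul_distrib]
  rw [mul_comm]
  congr 1
  · simp
  · refine (Equiv.prod_comp (Equiv.addRight (1 : Fin (l + 1)))
      fun j => A (i j)
        (Equiv.arrowCongr (Equiv.addRight (1 : Fin (l + 1))) (Equiv.refl m) y j) (x j)).symm.trans ?_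
    simp

/-- **Simultaneous unitary equivalence of tuples of matrices with a common row space,
with Laffey's bound `φ(n) = n²` on the word length** (Futorny–Horn–Sergeichuk,
Corollary 3(c)).  Let `A₁, …, A_k` and `B₁, …, B_k` (`k ≥ 1`) be complex matrices with
`m` rows, where `Aᵢ` and `Bᵢ` have `n i` columns.  If
`trace w(A₁ᴴA₁, …, A_kᴴA_k) = trace w(B₁ᴴB₁, …, B_kᴴB_k)` for every word `w` in `k`
noncommuting variables of length at most `(3(m + n₁ + ⋯ + n_k))²`, then there exist
unitary matrices `U` (of size `m × m`) and `V₁, …, V_k` (`Vᵢ` of size `n i × n i`) with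
`U * Aᵢ * Vᵢ = Bᵢ` for all `i`.  A word of length `ℓ = l + 1` is encoded as a function
`i : Fin (l+1) → Fin k`; since the matrices `Aᵢ` have varying numbers of columns, the
trace of the word of conjugate-transpose pairs is written in its (exactly equal,
cyclically regrouped) well-typed form
`trace ((A_{i₁}ᴴ A_{i₂})(A_{i₂}ᴴ A_{i₃}) ⋯ (A_{i_ℓ}ᴴ A_{i₁}))`,
where each factor `A_{i_j}ᴴ A_{i_{j+1}}` has size `n i_j × n i_{j+1}` and the index
`j + 1` is taken cyclically in `Fin (l+1)`. -/
theorem simultaneous_unitary_equivalence_tuples_of_bounded_traces (k : ℕ) (hk : 1 ≤ k)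
    (m : ℕ) (n : Fin k → ℕ) (A B : ∀ i : Fin k, Matrix (Fin m) (Fin (n i)) ℂ)
    (htr : ∀ (l : ℕ) (i : Fin (l + 1) → Fin k),
      l + 1 ≤ (3 * (m + ∑ i : Fin k, n i)) ^ 2 →
      (∑ x : ∀ j : Fin (l + 1), Fin (n (i j)),
        ∏ j : Fin (l + 1), ((A (i j))ᴴ * A (i (j + 1))) (x j) (x (j + 1))) =
      (∑ x : ∀ j : Fin (l + 1), Fin (n (i j)),
        ∏ j : Fin (l + 1), ((B (i j))ᴴ * B (i (j + 1))) (x j) (x (j + 1)))) :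
    ∃ (U : Matrix (Fin m) (Fin m) ℂ) (V : ∀ i : Fin k, Matrix (Fin (n i)) (Fin (n i)) ℂ),
      Uᴴ * U = 1 ∧ (∀ i : Fin k, (V i)ᴴ * V i = 1) ∧ ∀ i : Fin k, U * A i * V i = B i := by
  obtain ⟨U, hU, hUS⟩ := exists_unitary_conj_of_trace_eq
    (fun i => A i * (A i)ᴴ) (fun i => B i * (B i)ᴴ) (by simp) (by simp) (by
      intro w hw
      rcases w with _ | ⟨a, w⟩
      · simp
      have hlen : w.length + 1 ≤ (3 * (m + ∑ i : Fin k, n i)) ^ 2 := by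
        refine le_trans (by simpa using hw) (Nat.pow_le_pow_left ?_ 2)
        omega
      let i : Fin (w.length + 1) → Fin k := (a :: w).get
      have := htr w.length i hlen
      rw [← trace_prod_mul_conjTranspose A, ← trace_prod_mul_conjTranspose B] at this
      have hl : ∀ f : Fin k → Matrix (Fin m) (Fin m) ℂ,
          List.ofFn (fun j => f ((a :: w).get j)) = (a :: w).map f := fun f => by
        rw [← Function.comp_def, ← List.map_ofFn, List.ofFn_get]
      rw [← hl, ← hl]
      exact this)
  have hV : ∀ i, ∃ V : Matrix (Fin (n i)) (Fin (n i)) ℂ, Vᴴ * V = 1 ∧ U * A i * V = B i := by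
    intro i
    refine exists_unitary_mul_eq_of_mul_conjTranspose_eq _ _ ?_
    rw [conjTranspose_mul, ← mul_one (B i * (B i)ᴴ), ← mul_eq_one_comm.1 hU,
      ← Matrix.mul_assoc _ U, ← hUS i]
    simp only [Matrix.mul_assoc]
  choose V hV₁ hV₂ using hV
  exact ⟨U, V, hU, hV₁, hV₂⟩
end

section
/- Let A and B be m×m complex matrices conformally partitioned into t² blocks A = [A_{ij}] and B = [B_{ij}] (i,j = 1,…,t), where the diagonal blocks A_{ii}, B_{ii} are square of size d_i×d_i (so m = d₁+⋯+d_t). Then the following are equivalent: (i) there exist unitary matrices U₁,…,U_t with U_i of size d_i×d_i such that U⁻¹AU = B for U = U₁ ⊕ ⋯ ⊕ U_t (the block-diagonal matrix with diagonal blocks U₁,…,U_t); (ii) for every ℓ ≥ 1, all i₁,…,i_ℓ ∈ {1,…,t}, and all ε₁,…,ε_ℓ ∈ {1,*}, trace(A_{i₁i₂}^{(ε₁)} A_{i₂i₃}^{(ε₂)} ··· A_{i_{ℓ-1}i_ℓ}^{(ε_{ℓ-1})} A_{i_ℓ i₁}^{(ε_ℓ)}) = trace(B_{i₁i₂}^{(ε₁)}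 B_{i₂i₃}^{(ε₂)} ··· B_{i_{ℓ-1}i_ℓ}^{(ε_{ℓ-1})} B_{i_ℓ i₁}^{(ε_ℓ)}), where A_{ij}^{(1)} := A_{ij} and A_{ij}^{(*)} := (A_{ji})ᴴ (the conjugate transpose of the (j,i) block), and similarly for B. -/
open Matrix

section Semisimple

variable {k R : Type*} [Field k] [Ring R] [Algebra k R]

section

variable {M N : Type*} [AddCommGroup M] [Module k M] [Module R M] [IsScalarTower k R M]
  [AddCommGroup N] [Module k N] [Module R N] [IsScalarTower k R N]

theorem trace_lsmul_congr (e : M ≃ₗ[R] N) (r : R) :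
    LinearMap.trace k M (Algebra.lsmul k k M r) = LinearMap.trace k N (Algebra.lsmul k k N r) := by
  rw [← LinearMap.trace_conj' _ (e.restrictScalars k)]
  congr 1
  ext x
  simp [LinearEquiv.conj_apply]

theorem trace_lsmul_prod [FiniteDimensional k M] [FiniteDimensional k N] (r : R) :
    LinearMap.trace k (M × N) (Algebra.lsmul k k (M × N) r) =
      LinearMap.trace k M (Algebra.lsmul k k M r) + LinearMap.trace k N (Algebra.lsmul k k N r) := by
  rw [← LinearMap.trace_prodMap']
  rfl

theorem isSemisimpleModule_prod [IsSemisimpleModule R M] [IsSemisimpleModule R N] :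
    IsSemisimpleModule R (M × N) := by
  have := IsSemisimpleModule.sup (IsSemisimpleModule.range (LinearMap.inl R M N))
    (IsSemisimpleModule.range (LinearMap.inr R M N))
  rw [LinearMap.sup_range_inl_inr] at this
  exact .congr Submodule.topEquiv.symm

theorem finiteDimensional_of_submodule [FiniteDimensional k M] (p : Submodule R M) :
    FiniteDimensional k p :=
  inferInstanceAs (FiniteDimensional k (p.restrictScalars k))

theorem exists_smul_eq_fst_of_hom_eq_zero [FiniteDimensional k M] [FiniteDimensional k N]
    [IsSemisimpleModule R M] [IsSemisimpleModule R N]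
    (hMN : ∀ f : M →ₗ[R] N, f = 0) (hNM : ∀ f : N →ₗ[R] M, f = 0) :
    ∃ r : R, (∀ x : M, r • x = x) ∧ ∀ y : N, r • y = 0 := by
  let e : Module.End (Module.End R (M × N)) (M × N) :=
    { toFun := fun x => (x.1, 0)
      map_add' := fun x y => by simp
      map_smul' := fun φ x => by
        have h₁ := LinearMap.congr_fun (hMN (.snd R M N ∘ₗ φ ∘ₗ .inl R M N)) x.1
        have h₂ := LinearMap.congr_fun (hNM (.fst R M N ∘ₗ φ ∘ₗ .inr R M N)) x.2
        have h₃ : φ x = φ (x.1, 0) + φ (0, x.2) := by rw [← map_add]; simp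
        simp only [LinearMap.comp_apply, LinearMap.inl_apply, LinearMap.inr_apply,
          LinearMap.fst_apply, LinearMap.snd_apply, LinearMap.zero_apply] at h₁ h₂
        ext <;> simp [h₁, h₂, h₃] }
  obtain ⟨s, hs⟩ := Module.Finite.fg_top (R := k) (M := M × N)
  have := isSemisimpleModule_prod (R := R) (M := M) (N := N)
  obtain ⟨r, hr⟩ := jacobson_density e s
  have key : ∀ x : M × N, r • x = (x.1, 0) := by
    intro x
    have hx : x ∈ Submodule.span k (s : Set (M × N)) := hs ▸ Submodule.mem_top
    induction hx using Submodule.span_induction with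
    | mem x hx => exact (hr x hx).symm
    | zero => rw [smul_zero]; rfl
    | add x y _ _ hx hy => simp [hx, hy]
    | smul c x _ hx => rw [smul_comm, hx]; simp
  exact ⟨r, fun x => congrArg Prod.fst (key (x, 0)), fun y => congrArg Prod.snd (key (0, y))⟩

theorem hom_eq_zero_symm [IsSemisimpleModule R M] [IsSemisimpleModule R N]
    (hMN : ∀ f : M →ₗ[R] N, f = 0) (g : N →ₗ[R] M) : g = 0 := by
  obtain ⟨s, hs⟩ := IsSemisimpleModule.lifting_property g.rangeRestrict g.surjective_rangeRestrict
    LinearMap.id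
  obtain ⟨h, hh⟩ := IsSemisimpleModule.extension_property (LinearMap.range g).subtype
    (LinearMap.range g).subtype_injective s
  rw [hMN h, LinearMap.zero_comp] at hh
  ext x
  have := LinearMap.congr_fun hs (g.rangeRestrict x)
  rw [← hh] at this
  simpa using (congrArg Subtype.val this).symm

theorem exists_hom_ne_zero_of_trace_eq [CharZero k] [FiniteDimensional k M]
    [FiniteDimensional k N] [IsSemisimpleModule R M] [IsSemisimpleModule R N] [Nontrivial M]
    (h : ∀ r : R, LinearMap.trace k M (Algebra.lsmul k k M r) =
      LinearMap.trace k N (Algebra.lsmul k k N r)) :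
    ∃ f : M →ₗ[R] N, f ≠ 0 := by
  by_contra! hMN
  obtain ⟨r, hrM, hrN⟩ :=
    exists_smul_eq_fst_of_hom_eq_zero (k := k) hMN (hom_eq_zero_symm hMN)
  have h₁ : Algebra.lsmul k k M r = 1 := LinearMap.ext hrM
  have h₂ : Algebra.lsmul k k N r = 0 := LinearMap.ext hrN
  have := h r
  rw [h₁, h₂, LinearMap.trace_one, map_zero, Nat.cast_eq_zero] at this
  exact Module.finrank_pos.ne' this

end

/-- Over a field of characteristic zero, finite-dimensional semisimple modules with the same
character are isomorphic. -/
theorem nonempty_linearEquiv_of_trace_eq [CharZero k] {M N : Type*}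
    [AddCommGroup M] [Module k M] [Module R M] [IsScalarTower k R M]
    [AddCommGroup N] [Module k N] [Module R N] [IsScalarTower k R N]
    [FiniteDimensional k M] [FiniteDimensional k N]
    [IsSemisimpleModule R M] [IsSemisimpleModule R N]
    (h : ∀ r : R, LinearMap.trace k M (Algebra.lsmul k k M r) =
      LinearMap.trace k N (Algebra.lsmul k k N r)) :
    Nonempty (M ≃ₗ[R] N) := by
  induction hn : Module.finrank k M using Nat.strong_induction_on generalizing M N with
  | _ n ih =>
  subst hn
  cases subsingleton_or_nontrivial M with
  | inl hM =>
    have h₁ := h 1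
    rw [map_one (Algebra.lsmul k k M), map_one (Algebra.lsmul k k N), LinearMap.trace_one,
      LinearMap.trace_one, Nat.cast_inj,
      Module.finrank_zero_of_subsingleton] at h₁
    have := Module.finrank_zero_iff.mp h₁.symm
    exact ⟨0⟩
  | inr hM =>
    obtain ⟨f, hf⟩ := exists_hom_ne_zero_of_trace_eq h
    obtain ⟨C, hC⟩ := exists_isCompl (LinearMap.ker f)
    obtain ⟨D, hD⟩ := exists_isCompl (LinearMap.range f)
    have eC : C ≃ₗ[R] LinearMap.range f :=
      (Submodule.quotientEquivOfIsCompl _ _ hC).symm.trans f.quotKerEquivRange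
    have eM := Submodule.prodEquivOfIsCompl _ _ hC
    have eN := Submodule.prodEquivOfIsCompl _ _ hD
    have := finiteDimensional_of_submodule (k := k) (LinearMap.ker f)
    have := finiteDimensional_of_submodule (k := k) C
    have := finiteDimensional_of_submodule (k := k) (LinearMap.range f)
    have := finiteDimensional_of_submodule (k := k) D
    have hlt : Module.finrank k (LinearMap.ker f) < Module.finrank k M := by
      refine Submodule.finrank_lt (s := (LinearMap.ker f).restrictScalars k) fun htop => hf ?_
      ext x
      have hx : x ∈ (LinearMap.ker f).restrictScalars k := htop ▸ Submodule.mem_top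
      exact hx
    obtain ⟨e⟩ := ih _ hlt (M := LinearMap.ker f) (N := D) (fun r => by
      have := h r
      rw [← trace_lsmul_congr eM, ← trace_lsmul_congr eN, trace_lsmul_prod, trace_lsmul_prod,
        trace_lsmul_congr eC, add_comm (LinearMap.trace k (LinearMap.range f) _)] at this
      exact add_right_cancel this) rfl
    exact ⟨eM.symm ≪≫ₗ (e.prodCongr eC) ≪≫ₗ LinearEquiv.prodComm R _ _ ≪≫ₗ eN⟩

end Semisimple

section StarRepresentation

theorem exists_unitary_intertwiner_of_isUnit {A : Type*} [CStarAlgebra A] [PartialOrder A]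
    [StarOrderedRing A] {t : A} (ht : IsUnit t) :
    ∃ u ∈ unitary A, ∀ a b : A, a * t = t * b → star a * t = t * star b → a * u = u * b := by
  have hnonneg : 0 ≤ star t * t := star_mul_self_nonneg t
  have hss := CFC.sqrt_mul_sqrt_self (star t * t) hnonneg
  have hunit : IsUnit (CFC.sqrt (star t * t)) :=
    (CFC.isUnit_sqrt_iff (star t * t) hnonneg).mpr (ht.star.mul ht)
  have hsa : IsSelfAdjoint (CFC.sqrt (star t * t)) := (CFC.sqrt_nonneg _).isSelfAdjoint
  have hcomm : ∀ b : A, Commute (star t * t) b → Commute (CFC.sqrt (star t * t)) b := by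
    intro b hb
    rw [CFC.sqrt_eq_cfc]
    exact hb.cfc_nnreal _
  generalize CFC.sqrt (star t * t) = s at *
  obtain ⟨s, rfl⟩ := hunit
  have hsa' : star (↑s⁻¹ : A) = ↑s⁻¹ := by
    have : star s = s := Units.ext hsa
    rw [← Units.coe_star, star_inv, this]
  have hu : star (t * ↑s⁻¹) * (t * ↑s⁻¹) = 1 := by
    rw [star_mul, hsa', mul_assoc, ← mul_assoc (star t), ← hss]
    simp
  have huu : IsUnit (t * ↑s⁻¹) := ht.mul s⁻¹.isUnit
  refine ⟨t * ↑s⁻¹, Unitary.mem_iff.mpr ⟨hu, ?_⟩, fun a b hab hab' => ?_⟩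
  · obtain ⟨w, hw⟩ := huu
    rw [← hw] at hu ⊢
    rw [← Units.inv_eq_of_mul_eq_one_left hu]
    simp
  · have hb : Commute (star t * t) b := by
      have := congrArg star hab'
      rw [star_mul, star_mul, star_star, star_star] at this
      rw [Commute, SemiconjBy, mul_assoc, ← hab, ← mul_assoc, this, mul_assoc]
    have := (hcomm b hb).units_inv_left
    rw [← mul_assoc, hab, mul_assoc, mul_assoc, this.eq]

variable {R E : Type*} [Ring R] [StarRing R] [Algebra ℂ R] [NormedAddCommGroup E]
  [InnerProductSpace ℂ E] [FiniteDimensional ℂ E]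

/-- The Hilbert space of a `*`-representation, regarded as a module over the represented ring. -/
def StarRepModule (_φ : R →⋆ₐ[ℂ] (E →L[ℂ] E)) : Type _ := E

namespace StarRepModule

variable (φ : R →⋆ₐ[ℂ] (E →L[ℂ] E))

instance : AddCommGroup (StarRepModule φ) := inferInstanceAs (AddCommGroup E)

instance : Module ℂ (StarRepModule φ) := inferInstanceAs (Module ℂ E)

instance : FiniteDimensional ℂ (StarRepModule φ) := inferInstanceAs (FiniteDimensional ℂ E)

instance : Module R (StarRepModule φ) :=
  Module.compHom E (φ.toAlgHom : R →+* (E →L[ℂ] E))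

theorem smul_def (r : R) (x : StarRepModule φ) : r • x = (φ r : E →L[ℂ] E) x := rfl

instance : IsScalarTower ℂ R (StarRepModule φ) where
  smul_assoc c r x := by
    rw [smul_def, smul_def, map_smul]
    rfl

instance : IsSemisimpleModule R (StarRepModule φ) := by
  rw [isSemisimpleModule_iff]
  refine ⟨fun p => ?_⟩
  let p' : Submodule ℂ E := p.restrictScalars ℂ
  let q : Submodule R (StarRepModule φ) :=
    { carrier := SetLike.coe p'ᗮ
      add_mem' := p'ᗮ.add_mem
      zero_mem' := p'ᗮ.zero_mem
      smul_mem' := fun r (x : E) hx (y : E) hy => by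
        have : inner ℂ (φ (star r) y) x = 0 := hx _ (p.smul_mem (star r) hy)
        rwa [map_star, ContinuousLinearMap.star_eq_adjoint,
          ContinuousLinearMap.adjoint_inner_left] at this }
  have h : IsCompl p' p'ᗮ := Submodule.isCompl_orthogonal _
  refine ⟨q, ?_⟩
  rw [isCompl_iff, Submodule.disjoint_def, codisjoint_iff, Submodule.eq_top_iff'] at h ⊢
  refine ⟨h.1, fun x => ?_⟩
  obtain ⟨y, hy, z, hz, rfl⟩ := Submodule.mem_sup.mp (h.2 x)
  exact Submodule.add_mem_sup (S := p) (T := q) hy hz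

end StarRepModule

/-- Two `*`-representations on a finite-dimensional Hilbert space with the same character are
unitarily equivalent. -/
theorem exists_unitary_intertwiner_of_trace_eq (φ ψ : R →⋆ₐ[ℂ] (E →L[ℂ] E))
    (h : ∀ r, LinearMap.trace ℂ E (φ r : E →L[ℂ] E) = LinearMap.trace ℂ E (ψ r : E →L[ℂ] E)) :
    ∃ u ∈ unitary (E →L[ℂ] E), ∀ r, φ r * u = u * ψ r := by
  have hchar : ∀ r : R,
      LinearMap.trace ℂ (StarRepModule ψ) (Algebra.lsmul ℂ ℂ (StarRepModule ψ) r) =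
        LinearMap.trace ℂ (StarRepModule φ) (Algebra.lsmul ℂ ℂ (StarRepModule φ) r) :=
    fun r => (h r).symm
  obtain ⟨e⟩ := nonempty_linearEquiv_of_trace_eq hchar
  let T : E ≃L[ℂ] E := LinearEquiv.toContinuousLinearEquiv (e.restrictScalars ℂ : E ≃ₗ[ℂ] E)
  have hT : ∀ r, φ r * (T : E →L[ℂ] E) = T * ψ r := fun r =>
    ContinuousLinearMap.ext fun x => (e.map_smul r x).symm
  obtain ⟨u, hu, hu'⟩ := exists_unitary_intertwiner_of_isUnit
    (t := (T : E →L[ℂ] E)) ((ContinuousLinearEquiv.unitsEquiv ℂ E).symm T).isUnit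
  refine ⟨u, hu, fun r => hu' _ _ (hT r) ?_⟩
  rw [← map_star, ← map_star, hT]

theorem Matrix.exists_unitary_intertwiner_of_trace_eq {n : Type*} [Fintype n] [DecidableEq n]
    (φ ψ : R →⋆ₐ[ℂ] Matrix n n ℂ) (h : ∀ r, (φ r).trace = (ψ r).trace) :
    ∃ U ∈ unitary (Matrix n n ℂ), ∀ r, φ r * U = U * ψ r := by
  let Φ : Matrix n n ℂ ≃⋆ₐ[ℂ] _ := Matrix.toEuclideanCLM (n := n) (𝕜 := ℂ)
  have htr : ∀ M : Matrix n n ℂ, LinearMap.trace ℂ (EuclideanSpace ℂ n) (Φ M : EuclideanSpace ℂ n →L[ℂ] EuclideanSpace ℂ n) = M.trace := by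
    intro M
    rw [← Matrix.trace_toLin_eq M (EuclideanSpace.basisFun n ℂ).toBasis]
    congr 1
  obtain ⟨u, hu, hu'⟩ := _root_.exists_unitary_intertwiner_of_trace_eq
    ((Φ : Matrix n n ℂ →⋆ₐ[ℂ] EuclideanSpace ℂ n →L[ℂ] EuclideanSpace ℂ n).comp φ)
    ((Φ : Matrix n n ℂ →⋆ₐ[ℂ] EuclideanSpace ℂ n →L[ℂ] EuclideanSpace ℂ n).comp ψ)
    fun r => (htr _).trans ((h r).trans (htr _).symm)
  refine ⟨Φ.symm u, Unitary.map_mem Φ.symm hu, fun r => EquivLike.injective Φ ?_⟩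
  rw [map_mul, map_mul, Φ.apply_symm_apply]
  exact hu' r

end StarRepresentation

section CyclicTrace

variable {n S : Type*} [Fintype n] [DecidableEq n] [CommSemiring S]

theorem Matrix.prod_ofFn_apply {l : ℕ} (f : Fin (l + 1) → Matrix n n S) (a b : n) :
    (List.ofFn f).prod a b =
      ∑ y : Fin l → n, ∏ j, f j ((Fin.cons a y : Fin (l + 1) → n) j)
        ((Fin.snoc y b : Fin (l + 1) → n) j) := by
  induction l generalizing a with
  | zero => simp [Fin.snoc]
  | succ l ih =>
    rw [List.ofFn_succ, List.prod_cons, mul_apply,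
      ← (Fin.consEquiv fun _ : Fin (l + 1) => n).sum_comp, Fintype.sum_prod_type]
    refine Finset.sum_congr rfl fun c _ => ?_
    rw [ih, Finset.mul_sum]
    refine Finset.sum_congr rfl fun y _ => ?_
    rw [Fin.prod_univ_succ (n := l + 1)]
    change _ = f 0 a ((Fin.snoc (Fin.cons c y : Fin (l + 1) → n) b : Fin (l + 2) → n) 0) *
      ∏ j : Fin (l + 1), f j.succ ((Fin.cons c y : Fin (l + 1) → n) j)
        ((Fin.snoc (Fin.cons c y : Fin (l + 1) → n) b : Fin (l + 2) → n) j.succ)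
    rw [← Fin.cons_snoc_eq_snoc_cons]
    simp only [Fin.cons_zero, Fin.cons_succ]

theorem Matrix.trace_prod_ofFn {l : ℕ} (f : Fin (l + 1) → Matrix n n S) :
    (List.ofFn f).prod.trace = ∑ y : Fin (l + 1) → n, ∏ j, f j (y j) (y (j + 1)) := by
  rw [← (Fin.consEquiv fun _ : Fin (l + 1) => n).sum_comp, Fintype.sum_prod_type, Matrix.trace]
  refine Finset.sum_congr rfl fun a _ => ?_
  rw [diag_apply, prod_ofFn_apply]
  refine Finset.sum_congr rfl fun y _ => Finset.prod_congr rfl fun j _ => ?_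
  have : (Fin.snoc y a : Fin (l + 1) → n) j = (Fin.cons a y : Fin (l + 1) → n) (j + 1) := by
    refine Fin.lastCases ?_ (fun i => ?_) j
    · simp
    · rw [Fin.snoc_castSucc, Fin.coeSucc_eq_succ, Fin.cons_succ]
  rw [this]
  rfl

end CyclicTrace

section ColoredWords

variable {n ι : Type*} [DecidableEq n] [DecidableEq ι] {c : n → ι}

/-- The coordinate projection onto the indices of colour `i`. -/
def colorProj (c : n → ι) (i : ι) : Matrix n n ℂ := diagonal fun p => if c p = i then 1 else 0

theorem sum_colorProj [Fintype ι] : ∑ i, colorProj c i = 1 := by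
  ext p q
  simp only [Matrix.sum_apply, colorProj, diagonal_apply, one_apply]
  split_ifs <;> simp

theorem conjTranspose_colorProj (i : ι) : (colorProj c i)ᴴ = colorProj c i := by
  rw [colorProj, diagonal_conjTranspose]
  congr 1
  ext p
  simp only [Pi.star_apply]
  split_ifs <;> simp

variable [Fintype n]

theorem colorProj_mul_colorProj (i j : ι) :
    colorProj c i * colorProj c j = if i = j then colorProj c j else 0 := by
  rw [colorProj, colorProj, diagonal_mul_diagonal]
  split_ifs with h
  · subst h; simp
  · rw [← diagonal_zero]
    congr 1
    ext p
    grind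

theorem colorProj_mul_apply (i : ι) (M : Matrix n n ℂ) (p q : n) :
    (colorProj c i * M) p q = if c p = i then M p q else 0 := by
  simp [colorProj]

/-- The product of the matrices `colorProj c i * A` or `colorProj c i * Aᴴ` listed by a word. -/
def colorWord (c : n → ι) (A : Matrix n n ℂ) (w : List (ι × Bool)) : Matrix n n ℂ :=
  (w.map fun x => colorProj c x.1 * cond x.2 Aᴴ A).prod

theorem colorWord_cons (A : Matrix n n ℂ) (x : ι × Bool) (w : List (ι × Bool)) :
    colorWord c A (x :: w) = colorProj c x.1 * cond x.2 Aᴴ A * colorWord c A w :=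
  List.prod_cons

theorem colorWord_mul_comm {A B U : Matrix n n ℂ} (hU : Uᴴ * U = 1) (hAB : A * U = U * B)
    (hP : ∀ i, colorProj c i * U = U * colorProj c i) (w : List (ι × Bool)) :
    colorWord c A w * U = U * colorWord c B w := by
  have hAB' : Aᴴ * U = U * Bᴴ := by
    have h₁ : Uᴴ * Aᴴ = Bᴴ * Uᴴ := by rw [← conjTranspose_mul, hAB, conjTranspose_mul]
    have h₂ : U * Uᴴ = 1 := mul_eq_one_comm.mp hU
    calc Aᴴ * U = U * (Uᴴ * Aᴴ) * U := by rw [← mul_assoc, h₂, one_mul]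
      _ = U * Bᴴ := by rw [h₁, mul_assoc, mul_assoc, hU, mul_one]
  induction w with
  | nil => simp [colorWord]
  | cons x w ih =>
    have : cond x.2 Aᴴ A * U = U * cond x.2 Bᴴ B := by cases x.2 <;> assumption
    rw [colorWord_cons, colorWord_cons, mul_assoc, ih, ← mul_assoc, mul_assoc (colorProj c x.1),
      this, ← mul_assoc (colorProj c x.1), hP]
    simp only [mul_assoc]

theorem trace_colorWord_eq_of_unitary {A B U : Matrix n n ℂ} (hU : Uᴴ * U = 1)
    (hAB : A * U = U * B) (hP : ∀ i, colorProj c i * U = U * colorProj c i)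
    (w : List (ι × Bool)) : (colorWord c A w).trace = (colorWord c B w).trace := by
  rw [← mul_one (colorWord c A w), ← mul_eq_one_comm.mp hU, ← mul_assoc,
    colorWord_mul_comm hU hAB hP, trace_mul_comm, ← mul_assoc, hU, one_mul]

theorem trace_colorWord_mul_colorProj {A B : Matrix n n ℂ}
    (h : ∀ w : List (ι × Bool), w ≠ [] → (colorWord c A w).trace = (colorWord c B w).trace)
    (w : List (ι × Bool)) (j : ι) :
    (colorWord c A w * colorProj c j).trace = (colorWord c B w * colorProj c j).trace := by
  cases w with
  | nil => rfl
  | cons x w =>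
    rw [trace_mul_comm, trace_mul_comm (colorWord c B _), colorWord_cons, colorWord_cons,
      mul_assoc, mul_assoc (colorProj c x.1), ← mul_assoc, ← mul_assoc (colorProj c j),
      colorProj_mul_colorProj]
    split_ifs
    · rw [← mul_assoc, ← mul_assoc, ← colorWord_cons, ← colorWord_cons]
      exact h _ (List.cons_ne_nil _ _)
    · simp

/-- The pairs of matrices obtained from `(A, B)` and the colour projections. -/
def colorGenerators (c : n → ι) (A B : Matrix n n ℂ) : Set (Matrix n n ℂ × Matrix n n ℂ) :=
  insert (A, B) (Set.range fun i => (colorProj c i, colorProj c i))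

/-- The span of the pairs of matrices given by a word followed by a colour projection. -/
def colorWordSpan (c : n → ι) (A B : Matrix n n ℂ) :
    Submodule ℂ (Matrix n n ℂ × Matrix n n ℂ) :=
  Submodule.span ℂ (Set.range fun x : List (ι × Bool) × ι =>
    (colorWord c A x.1 * colorProj c x.2, colorWord c B x.1 * colorProj c x.2))

theorem mem_colorWordSpan (A B : Matrix n n ℂ) (w : List (ι × Bool)) (j : ι) :
    (colorWord c A w * colorProj c j, colorWord c B w * colorProj c j) ∈ colorWordSpan c A B :=
  Submodule.subset_span ⟨(w, j), rfl⟩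

theorem colorProj_mul_mem_colorWordSpan {A B : Matrix n n ℂ} (i : ι)
    {z : Matrix n n ℂ × Matrix n n ℂ} (hz : z ∈ colorWordSpan c A B) :
    (colorProj c i, colorProj c i) * z ∈ colorWordSpan c A B := by
  refine Submodule.span_le (p := (colorWordSpan c A B).comap (LinearMap.mulLeft ℂ _)).mpr ?_ hz
  rintro _ ⟨⟨w, j⟩, rfl⟩
  simp only [Submodule.comap_coe, Set.mem_preimage, LinearMap.mulLeft_apply, SetLike.mem_coe,
    Prod.mk_mul_mk]
  cases w with
  | nil =>
    simp only [colorWord, List.map_nil, List.prod_nil, one_mul, colorProj_mul_colorProj]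
    split_ifs
    · simpa [colorWord] using mem_colorWordSpan (c := c) A B [] j
    · exact zero_mem _
  | cons x w =>
    have key : ∀ M : Matrix n n ℂ, colorProj c i * (colorWord c M (x :: w) * colorProj c j) =
        if i = x.1 then colorWord c M (x :: w) * colorProj c j else 0 := by
      intro M
      rw [colorWord_cons, mul_assoc, mul_assoc, ← mul_assoc, colorProj_mul_colorProj]
      split_ifs <;> simp
    rw [key, key]
    split_ifs
    · exact mem_colorWordSpan A B _ j
    · exact zero_mem _

variable [Fintype ι]

theorem cond_mul_mem_colorWordSpan {A B : Matrix n n ℂ} (e : Bool)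
    {z : Matrix n n ℂ × Matrix n n ℂ} (hz : z ∈ colorWordSpan c A B) :
    (cond e Aᴴ A, cond e Bᴴ B) * z ∈ colorWordSpan c A B := by
  refine Submodule.span_le (p := (colorWordSpan c A B).comap (LinearMap.mulLeft ℂ _)).mpr ?_ hz
  rintro _ ⟨⟨w, j⟩, rfl⟩
  simp only [Submodule.comap_coe, Set.mem_preimage, LinearMap.mulLeft_apply, SetLike.mem_coe,
    Prod.mk_mul_mk]
  have key : ∀ M : Matrix n n ℂ, cond e Mᴴ M * (colorWord c M w * colorProj c j) =
      ∑ i, colorWord c M ((i, e) :: w) * colorProj c j := by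
    intro M
    simp only [colorWord_cons, ← Finset.sum_mul, sum_colorProj, one_mul, mul_assoc]
  rw [key, key, prod_mk_sum]
  exact sum_mem fun i _ => mem_colorWordSpan A B _ j

theorem adjoin_colorGenerators_le (A B : Matrix n n ℂ) :
    (StarAlgebra.adjoin ℂ (colorGenerators c A B)).toSubalgebra.toSubmodule ≤
      colorWordSpan c A B := by
  rw [StarAlgebra.adjoin_eq_span, Submodule.span_le]
  intro z hz
  induction hz using Submonoid.closure_induction_left with
  | one =>
    have : (1 : Matrix n n ℂ × Matrix n n ℂ) =
        ∑ j, (colorWord c A [] * colorProj c j, colorWord c B [] * colorProj c j) := by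
      simp only [colorWord, List.map_nil, List.prod_nil, one_mul, ← prod_mk_sum, sum_colorProj]
      rfl
    rw [this]
    exact sum_mem fun j _ => mem_colorWordSpan A B [] j
  | mul_left x hx y _ hy =>
    rcases hx with (rfl | ⟨i, rfl⟩) | hx
    · exact cond_mul_mem_colorWordSpan false hy
    · exact colorProj_mul_mem_colorWordSpan i hy
    · rcases Set.mem_star.mp hx with hx | ⟨i, hx⟩
      · obtain rfl : x = (Aᴴ, Bᴴ) := by rw [← star_star x, hx]; rfl
        exact cond_mul_mem_colorWordSpan true hy
      · obtain rfl : x = (colorProj c i, colorProj c i) := by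
          rw [← star_star x, ← hx]
          exact Prod.ext (conjTranspose_colorProj i) (conjTranspose_colorProj i)
        exact colorProj_mul_mem_colorWordSpan i hy

theorem exists_unitary_of_trace_colorWord_eq {A B : Matrix n n ℂ}
    (h : ∀ w : List (ι × Bool), w ≠ [] → (colorWord c A w).trace = (colorWord c B w).trace) :
    ∃ U : Matrix n n ℂ, Uᴴ * U = 1 ∧ A * U = U * B ∧
      ∀ i, colorProj c i * U = U * colorProj c i := by
  let R := StarAlgebra.adjoin ℂ (colorGenerators c A B)
  let T : Submodule ℂ (Matrix n n ℂ × Matrix n n ℂ) := LinearMap.eqLocus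
    (traceLinearMap n ℂ ℂ ∘ₗ LinearMap.fst ℂ _ _) (traceLinearMap n ℂ ℂ ∘ₗ LinearMap.snd ℂ _ _)
  have hT : colorWordSpan c A B ≤ T := by
    refine Submodule.span_le.mpr ?_
    rintro _ ⟨⟨w, j⟩, rfl⟩
    exact trace_colorWord_mul_colorProj h w j
  obtain ⟨U, hU, hUR⟩ := Matrix.exists_unitary_intertwiner_of_trace_eq
    ((StarAlgHom.fst ℂ (Matrix n n ℂ) (Matrix n n ℂ)).comp R.subtype)
    ((StarAlgHom.snd ℂ (Matrix n n ℂ) (Matrix n n ℂ)).comp R.subtype)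
    fun r => hT (adjoin_colorGenerators_le A B r.2)
  have hgen : ∀ z ∈ colorGenerators c A B, z.1 * U = U * z.2 := fun z hz =>
    hUR ⟨z, StarAlgebra.subset_adjoin ℂ _ hz⟩
  exact ⟨U, (Unitary.mem_iff.mp hU).1, hgen _ (Set.mem_insert _ _),
    fun i => hgen _ (Set.mem_insert_of_mem _ ⟨i, rfl⟩)⟩

end ColoredWords

section Blocks

variable {ι : Type*} [Fintype ι] [DecidableEq ι] {d : ι → ℕ}

theorem colorProj_mul_blockDiagonal' (U : ∀ i, Matrix (Fin (d i)) (Fin (d i)) ℂ) (i : ι) :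
    colorProj Sigma.fst i * blockDiagonal' U = blockDiagonal' U * colorProj Sigma.fst i := by
  ext p q
  rw [colorProj, diagonal_mul, mul_diagonal]
  by_cases h : p.1 = q.1
  · rw [h, mul_comm]
  · rw [blockDiagonal'_apply_ne _ _ _ h]
    simp

theorem blockDiagonal'_blockDiag'_of_colorProj_comm
    {U : Matrix (Σ i, Fin (d i)) (Σ i, Fin (d i)) ℂ}
    (hU : ∀ i, colorProj Sigma.fst i * U = U * colorProj Sigma.fst i) :
    blockDiagonal' (blockDiag' U) = U := by
  ext ⟨i, a⟩ ⟨j, b⟩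
  by_cases h : i = j
  · subst h
    rw [blockDiagonal'_apply_eq, blockDiag'_apply]
  · rw [blockDiagonal'_apply_ne _ _ _ h]
    have := congrFun (congrFun (hU i) ⟨i, a⟩) ⟨j, b⟩
    rw [colorProj, diagonal_mul, mul_diagonal] at this
    simpa [Ne.symm h] using this.symm

theorem trace_colorWord_ofFn (A : ∀ i j : ι, Matrix (Fin (d i)) (Fin (d j)) ℂ) {l : ℕ}
    (i : Fin (l + 1) → ι) (ε : Fin (l + 1) → Bool) :
    (colorWord Sigma.fst (Matrix.of fun p q : Σ i, Fin (d i) => A p.1 q.1 p.2 q.2)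
      (List.ofFn fun j => (i j, ε j))).trace =
      ∑ x : ∀ j : Fin (l + 1), Fin (d (i j)), ∏ j : Fin (l + 1),
        (cond (ε j) (A (i (j + 1)) (i j))ᴴ (A (i j) (i (j + 1)))) (x j) (x (j + 1)) := by
  rw [colorWord, List.map_ofFn, trace_prod_ofFn]
  symm
  refine Fintype.sum_of_injective
    (fun (x : ∀ j : Fin (l + 1), Fin (d (i j))) j => (⟨i j, x j⟩ : Σ i, Fin (d i))) ?_ _ _ ?_ ?_
  · intro x y hxy
    funext j
    exact eq_of_heq (Sigma.mk.inj (congrFun hxy j)).2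
  · intro y hy
    obtain ⟨j, hj⟩ : ∃ j, (y j).1 ≠ i j := by
      by_contra! hall
      obtain rfl : (fun j => (y j).1) = i := funext hall
      exact hy ⟨fun j => (y j).2, rfl⟩
    refine Finset.prod_eq_zero (Finset.mem_univ j) ?_
    rw [Function.comp_apply, colorProj_mul_apply, if_neg hj]
  · intro x
    refine Finset.prod_congr rfl fun j _ => ?_
    rw [Function.comp_apply, colorProj_mul_apply, if_pos rfl]
    cases ε j <;> rfl

end Blocks

/-- **Block unitary similarity criterion** (Futorny–Horn–Sergeichuk, Corollary 4,
unitary case).  Let `A = [A i j]` and `B = [B i j]` be conformally partitioned `m × m`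
complex matrices with square diagonal blocks of sizes `d 1, …, d t` (the full matrices
are indexed by the sigma type `Σ i, Fin (d i)`, with `(i, j)` block `A i j` of size
`d i × d j`).  The following are equivalent:

(i) `U⁻¹ * A * U = B` for some block-diagonal `U = U₁ ⊕ ⋯ ⊕ U_t` with every `Uᵢ`
unitary of size `d i × d i`;

(ii) for every `ℓ ≥ 1` (encoded as `ℓ = l + 1`), all `i₁, …, i_ℓ ∈ {1, …, t}` (encoded
as `i : Fin (l+1) → Fin t`) and all `ε₁, …, ε_ℓ ∈ {1, *}` (encoded as
`ε : Fin (l+1) → Bool`, `false` for `1` and `true` for `*`),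
`trace (A_{i₁i₂}^{(ε₁)} A_{i₂i₃}^{(ε₂)} ⋯ A_{i_ℓ i₁}^{(ε_ℓ)}) =
 trace (B_{i₁i₂}^{(ε₁)} B_{i₂i₃}^{(ε₂)} ⋯ B_{i_ℓ i₁}^{(ε_ℓ)})`,
where `A_{ij}^{(1)} = A i j` and `A_{ij}^{(*)} = (A j i)ᴴ`.  Since the blocks have
varying sizes, the trace of the product is expressed entrywise:
`trace (M₁ ⋯ M_ℓ) = ∑ over all x with x j ∈ Fin (d (i j)) of ∏ j, M j (x j) (x (j+1))`,
the index `j + 1` being taken cyclically in `Fin (l+1)`. -/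
theorem block_unitary_similarity_iff_traces (t : ℕ) (d : Fin t → ℕ)
    (A B : ∀ i j : Fin t, Matrix (Fin (d i)) (Fin (d j)) ℂ) :
    (∃ U : ∀ i : Fin t, Matrix (Fin (d i)) (Fin (d i)) ℂ,
      (∀ i : Fin t, (U i)ᴴ * U i = 1) ∧
      (blockDiagonal' U)⁻¹ *
          (Matrix.of fun p q : Σ i : Fin t, Fin (d i) => A p.1 q.1 p.2 q.2) *
          blockDiagonal' U =
        Matrix.of fun p q : Σ i : Fin t, Fin (d i) => B p.1 q.1 p.2 q.2) ↔
    (∀ (l : ℕ) (i : Fin (l + 1) → Fin t) (ε : Fin (l + 1) → Bool),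
      (∑ x : ∀ j : Fin (l + 1), Fin (d (i j)),
        ∏ j : Fin (l + 1),
          (cond (ε j) (A (i (j + 1)) (i j))ᴴ (A (i j) (i (j + 1)))) (x j) (x (j + 1))) =
      (∑ x : ∀ j : Fin (l + 1), Fin (d (i j)),
        ∏ j : Fin (l + 1),
          (cond (ε j) (B (i (j + 1)) (i j))ᴴ (B (i j) (i (j + 1)))) (x j) (x (j + 1)))) := by
  set M := Matrix.of fun p q : Σ i : Fin t, Fin (d i) => A p.1 q.1 p.2 q.2
  set N := Matrix.of fun p q : Σ i : Fin t, Fin (d i) => B p.1 q.1 p.2 q.2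
  have unitary_iff : ∀ U : ∀ i : Fin t, Matrix (Fin (d i)) (Fin (d i)) ℂ,
      (∀ i, (U i)ᴴ * U i = 1) ↔ (blockDiagonal' U)ᴴ * blockDiagonal' U = 1 := by
    intro U
    rw [blockDiagonal'_conjTranspose, ← blockDiagonal'_mul, ← blockDiagonal'_one,
      blockDiagonal'_inj, funext_iff]
    rfl
  have similar_iff : ∀ V : Matrix (Σ i : Fin t, Fin (d i)) (Σ i : Fin t, Fin (d i)) ℂ,
      Vᴴ * V = 1 → (V⁻¹ * M * V = N ↔ M * V = V * N) := by
    intro V hV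
    have hV' : V * Vᴴ = 1 := mul_eq_one_comm.mp hV
    rw [inv_eq_left_inv hV]
    constructor
    · rintro h
      rw [← h, ← mul_assoc, ← mul_assoc, hV', one_mul]
    · intro h
      rw [mul_assoc, h, ← mul_assoc, hV, one_mul]
  constructor
  · rintro ⟨U, hU, hUM⟩ l i ε
    rw [unitary_iff] at hU
    rw [← trace_colorWord_ofFn, ← trace_colorWord_ofFn]
    exact trace_colorWord_eq_of_unitary hU ((similar_iff _ hU).mp hUM)
      (colorProj_mul_blockDiagonal' U) _
  · intro h
    obtain ⟨V, hV, hMN, hP⟩ := exists_unitary_of_trace_colorWord_eq (c := Sigma.fst)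
      (A := M) (B := N) fun w hw => by
        obtain ⟨l, hl⟩ := Nat.exists_eq_succ_of_ne_zero (List.length_pos_iff.mpr hw).ne'
        obtain ⟨f, rfl⟩ : ∃ f : Fin (l + 1) → Fin t × Bool, w = List.ofFn f :=
          ⟨fun j => w.get (j.cast hl.symm), by
            rw [← List.ofFn_congr hl w.get, List.ofFn_get]⟩
        have := h l (fun j => (f j).1) (fun j => (f j).2)
        rwa [← trace_colorWord_ofFn, ← trace_colorWord_ofFn] at this
    have hVd := blockDiagonal'_blockDiag'_of_colorProj_comm hP
    refine ⟨blockDiag' V, ?_, ?_⟩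
    · rwa [unitary_iff, hVd]
    · rw [hVd]
      exact (similar_iff V hV).mpr hMN
end
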